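/- arXiv:0704.2560 — 5 statements merged into one kernel-verified Lean document; each statement's English description precedes it below -/
import Mathlib

section
/- For every integer d ≥ 3 there exists a unique σ-finite measure ν on (W*, 𝒲*) such that for every finite K ⊆ ℤ^d the restriction of ν to W*_K equals the image of Q_K under π*, i.e. 1_{W*_K}·ν = π* ∘ Q_K. -/
/-!
Random interlacements (Sznitman): existence and uniqueness of the σ-finite
intensity measure ν on W* with `1_{W*_K} ν = π* ∘ Q_K` for all finite K ⊆ ℤ^d.
-/

open MeasureTheory
open scoped ENNReal

abbrev Zd (d : ℕ) := Fin d → ℤ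

/-- Nearest-neighbor adjacency on `ℤ^d`. -/
def adj {d : ℕ} (x y : Zd d) : Prop := (∑ i, (x i - y i).natAbs) = 1

instance {d : ℕ} (x y : Zd d) : Decidable (adj x y) := by
  unfold adj; infer_instance

/-- `P` is the family of laws of simple random walk on `ℤ^d`, characterized by its
finite-dimensional (cylinder) distributions. -/
def IsSRW (d : ℕ) (P : Zd d → Measure (ℕ → Zd d)) : Prop :=
  (∀ x, IsProbabilityMeasure (P x)) ∧
  ∀ (x : Zd d) (N : ℕ) (γ : ℕ → Zd d), γ 0 = x →
    P x {w | ∀ k ≤ N, w k = γ k} =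
      if ∀ k < N, adj (γ (k + 1)) (γ k) then ((2 * d : ℝ≥0∞))⁻¹ ^ N else 0

/-- The event `{H̃_K = ∞}` (the walk never returns to `K` after time `0`). -/
def escSet (d : ℕ) (K : Finset (Zd d)) : Set (ℕ → Zd d) :=
  {ω | ∀ n : ℕ, 1 ≤ n → ω n ∉ K}

/-- The set `W` of doubly infinite nearest-neighbor trajectories spending finite time
in every finite subset of `ℤ^d`. -/
def goodPath (d : ℕ) : Set (ℤ → Zd d) :=
  {w | (∀ n : ℤ, adj (w (n + 1)) (w n)) ∧ ∀ A : Finset (Zd d), {n : ℤ | w n ∈ A}.Finite}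

/-- The space `W` as a measurable space. -/
abbrev WT (d : ℕ) := {w : ℤ → Zd d // w ∈ goodPath d}

/-- Characterization (1.24) of the finite measure `Q_K` on `W` (supported on `W^0_K`):
for all `x`, `A`, `B`, `Q_K[(X_{-n})_{n≥0} ∈ A, X_0 = x, (X_n)_{n≥0} ∈ B] =
P_x[A | H̃_K = ∞] e_K(x) P_x[B]`, the right-hand side being written here as
`P_x[A ∩ {H̃_K = ∞}] P_x[B]` for `x ∈ K` (and `0` otherwise), which is the same
quantity with the convention that the conditional probability is `0` when `e_K(x) = 0`. -/
def IsQK (d : ℕ) (P : Zd d → Measure (ℕ → Zd d)) (K : Finset (Zd d))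
    (Q : Measure (WT d)) : Prop :=
  ∀ (x : Zd d) (A B : Set (ℕ → Zd d)), MeasurableSet A → MeasurableSet B →
    Q {w : WT d | (fun n : ℕ => w.1 (-(n : ℤ))) ∈ A ∧ w.1 0 = x ∧
        (fun n : ℕ => w.1 (n : ℤ)) ∈ B}
      = if x ∈ K then P x (A ∩ escSet d K) * P x B else 0

/-- Equivalence of trajectories modulo time shift. -/
def shiftSetoid (d : ℕ) : Setoid (WT d) where
  r w w' := ∃ k : ℤ, ∀ n : ℤ, w'.1 n = w.1 (n + k)
  iseqv := by
    constructor
    · exact fun w => ⟨0, fun n => by simp⟩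
    · rintro w w' ⟨k, hk⟩
      refine ⟨-k, fun n => ?_⟩
      have e : n + -k + k = n := by ring
      rw [hk (n + -k), e]
    · rintro w w' w'' ⟨k₁, h₁⟩ ⟨k₂, h₂⟩
      refine ⟨k₂ + k₁, fun n => ?_⟩
      have e : n + k₂ + k₁ = n + (k₂ + k₁) := by ring
      rw [h₂ n, h₁ (n + k₂), e]

/-- The space `W* = W/∼` of trajectories modulo time shift. -/
def WStar (d : ℕ) := Quotient (shiftSetoid d)

/-- The σ-algebra `𝒲* = {A ⊆ W* : (π*)⁻¹(A) ∈ 𝒲}`. -/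
noncomputable instance (d : ℕ) : MeasurableSpace (WStar d) :=
  MeasurableSpace.map (Quotient.mk (shiftSetoid d)) inferInstance

/-- `W*_K = π*(W_K)`, the set of equivalence classes of trajectories entering `K`. -/
def WstarK (d : ℕ) (K : Finset (Zd d)) : Set (WStar d) :=
  Quotient.mk (shiftSetoid d) '' {w : WT d | ∃ n : ℤ, w.1 n ∈ K}

namespace Interl

variable {d : ℕ}

/-- shift -/
def sh (k : ℤ) (w : ℤ → Zd d) : ℤ → Zd d := fun n => w (n + k)

lemma sh_meas (k : ℤ) : Measurable (sh (d := d) k) :=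
  measurable_pi_lambda _ fun n => measurable_pi_apply (n + k)

lemma sh_sh (j k : ℤ) (w : ℤ → Zd d) : sh j (sh k w) = sh (j + k) w := by
  funext n; simp [sh, add_assoc]

lemma sh_zero (w : ℤ → Zd d) : sh 0 w = w := by
  funext n; simp [sh]

lemma adj_comm' (x y : Zd d) : adj x y ↔ adj y x := by
  unfold adj
  have : ∀ i, (x i - y i).natAbs = (y i - x i).natAbs := fun i => by omega
  simp [this]

/-- cylinder -/
def cyl (p q : ℕ) (γ : ℤ → Zd d) : Set (ℤ → Zd d) :=
  {w | ∀ k : ℤ, -(p : ℤ) ≤ k → k ≤ q → w k = γ k}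

def bk (w : ℤ → Zd d) : ℕ → Zd d := fun n => w (-(n : ℤ))
def fw (w : ℤ → Zd d) : ℕ → Zd d := fun n => w (n : ℤ)

lemma bk_meas : Measurable (bk (d := d)) :=
  measurable_pi_lambda _ fun n => measurable_pi_apply _
lemma fw_meas : Measurable (fw (d := d)) :=
  measurable_pi_lambda _ fun n => measurable_pi_apply _

lemma meas_ev {ι : Type*} (n : ι) (s : Set (Zd d)) :
    MeasurableSet {w : ι → Zd d | w n ∈ s} :=
  measurable_pi_apply n (MeasurableSet.of_discrete (s := s))

lemma meas_ev2 {ι : Type*} (n m : ι) (r : Zd d → Zd d → Prop) :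
    MeasurableSet {w : ι → Zd d | r (w n) (w m)} := by
  have : Measurable (fun w : ι → Zd d => (w n, w m)) :=
    (measurable_pi_apply n).prodMk (measurable_pi_apply m)
  exact this (MeasurableSet.of_discrete (s := {p : Zd d × Zd d | r p.1 p.2}))

def nc (N : ℕ) (γ : ℕ → Zd d) : Set (ℕ → Zd d) := {w | ∀ k ≤ N, w k = γ k}

lemma nc_meas (N : ℕ) (γ : ℕ → Zd d) : MeasurableSet (nc N γ) := by
  unfold nc
  simp only [Set.setOf_forall]
  exact MeasurableSet.iInter fun k => MeasurableSet.iInter fun _ => meas_ev k {γ k}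

lemma cyl_eq (p q : ℕ) (γ : ℤ → Zd d) :
    cyl p q γ = {w | bk w ∈ nc p (bk γ) ∧ fw w ∈ nc q (fw γ)} := by
  ext w
  simp only [cyl, nc, bk, fw, Set.mem_setOf_eq]
  constructor
  · intro h
    exact ⟨fun k hk => h _ (by omega) (by omega), fun k hk => h _ (by omega) (by omega)⟩
  · rintro ⟨h1, h2⟩ k hk1 hk2
    rcases le_total 0 k with h | h
    · obtain ⟨m, rfl⟩ := Int.eq_ofNat_of_zero_le h
      exact h2 m (by omega)
    · obtain ⟨m, hm⟩ := Int.eq_ofNat_of_zero_le (a := -k) (by omega)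
      have : k = -(m : ℤ) := by omega
      subst this
      exact h1 m (by omega)

lemma cyl_meas (p q : ℕ) (γ : ℤ → Zd d) : MeasurableSet (cyl p q γ) := by
  rw [cyl_eq]
  exact (bk_meas (nc_meas _ _)).inter (fw_meas (nc_meas _ _))

def CC (d : ℕ) : Set (Set (ℤ → Zd d)) := {s | ∃ (a : ℕ) (γ : ℤ → Zd d), s = cyl (a+1) (a+1) γ}

/-- extension of a finite path -/
noncomputable def ex (a : ℕ) (g : (Finset.Icc (-((a+1 : ℕ) : ℤ)) ((a+1 : ℕ) : ℤ)) → Zd d) : ℤ → Zd d :=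
  fun n => if h : n ∈ Finset.Icc (-((a+1 : ℕ) : ℤ)) ((a+1 : ℕ) : ℤ) then g ⟨n, h⟩ else 0

lemma mem_cyl_ex (a : ℕ) (w : ℤ → Zd d) : w ∈ cyl (a+1) (a+1) (ex a (fun i => w i.1)) := by
  intro k h1 h2
  have : k ∈ Finset.Icc (-((a+1 : ℕ) : ℤ)) ((a+1 : ℕ) : ℤ) := Finset.mem_Icc.2 ⟨h1, h2⟩
  simp only [ex]
  rw [dif_pos this]

lemma gen : (MeasurableSpace.pi : MeasurableSpace (ℤ → Zd d)) =
    MeasurableSpace.generateFrom (CC d) := by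
  apply le_antisymm
  · refine iSup_le fun k => ?_
    rw [← measurable_iff_comap_le]
    refine @measurable_to_countable' _ _ _ _ (MeasurableSpace.generateFrom (CC d)) _ fun x => ?_
    have : (fun w : ℤ → Zd d => w k) ⁻¹' {x} =
        ⋃ g : {g : (Finset.Icc (-((k.natAbs+1 : ℕ) : ℤ)) ((k.natAbs+1 : ℕ) : ℤ)) → Zd d //
          ex k.natAbs g k = x}, cyl (k.natAbs+1) (k.natAbs+1) (ex k.natAbs g.1) := by
      ext w
      simp only [Set.mem_preimage, Set.mem_singleton_iff, Set.mem_iUnion]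
      constructor
      · intro h
        refine ⟨⟨fun i => w i.1, ?_⟩, mem_cyl_ex _ _⟩
        rw [← h]
        exact (mem_cyl_ex k.natAbs w k (by omega) (by omega)).symm
      · rintro ⟨g, hg⟩
        rw [← g.2]
        exact hg k (by omega) (by omega)
    rw [this]
    exact MeasurableSet.iUnion fun g => MeasurableSpace.measurableSet_generateFrom ⟨_, _, rfl⟩
  · refine MeasurableSpace.generateFrom_le ?_
    rintro _ ⟨a, γ, rfl⟩
    exact cyl_meas _ _ _

lemma piS : IsPiSystem (CC d) := by
  rintro _ ⟨a, γ, rfl⟩ _ ⟨b, δ, rfl⟩ ⟨w, hw1, hw2⟩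
  refine ⟨max a b, w, ?_⟩
  ext v
  constructor
  · rintro ⟨h1, h2⟩ k hk1 hk2
    rcases le_total a b with h | h
    · rw [h2 k (by omega) (by omega), hw2 k (by omega) (by omega)]
    · rw [h1 k (by omega) (by omega), hw1 k (by omega) (by omega)]
  · intro h
    exact ⟨fun k hk1 hk2 => by rw [h k (by omega) (by omega), hw1 k hk1 hk2],
      fun k hk1 hk2 => by rw [h k (by omega) (by omega), hw2 k hk1 hk2]⟩

lemma ext_cyl (μ ν : Measure (ℤ → Zd d))
    (h : ∀ (a : ℕ) γ, μ (cyl (a+1) (a+1) γ) = ν (cyl (a+1) (a+1) γ))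
    (hf : ∀ (a : ℕ) γ, μ (cyl (a+1) (a+1) γ) ≠ ∞) : μ = ν := by
  refine Measure.ext_of_generateFrom_of_cover_subset (S := CC d)
    (T := Set.range fun g => cyl 1 1 (ex 0 g)) gen piS ?_ (Set.countable_range _) ?_ ?_ ?_
  · rintro _ ⟨g, rfl⟩
    exact ⟨0, _, rfl⟩
  · rw [Set.sUnion_range, Set.eq_univ_iff_forall]
    intro w
    exact Set.mem_iUnion.2 ⟨_, mem_cyl_ex 0 w⟩
  · rintro _ ⟨g, rfl⟩
    exact hf 0 _
  · rintro _ ⟨a, γ, rfl⟩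
    exact h a γ

/-- glue -/
def gl (p : (ℕ → Zd d) × (ℕ → Zd d)) : ℤ → Zd d :=
  fun n => if 0 ≤ n then p.2 n.toNat else p.1 (-n).toNat

lemma gl_meas : Measurable (gl (d := d)) := by
  refine measurable_pi_lambda _ fun n => ?_
  unfold gl
  split_ifs
  · exact (measurable_pi_apply _).comp measurable_snd
  · exact (measurable_pi_apply _).comp measurable_fst

lemma fw_gl (p : (ℕ → Zd d) × (ℕ → Zd d)) : fw (gl p) = p.2 := by
  funext n; simp [fw, gl]

lemma bk_gl (p : (ℕ → Zd d) × (ℕ → Zd d)) (h : p.1 0 = p.2 0) : bk (gl p) = p.1 := by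
  funext n
  rcases Nat.eq_zero_or_pos n with rfl | hn
  · simp [bk, gl, h]
  · have : ¬ (0 : ℤ) ≤ -(n : ℤ) := by omega
    simp only [bk, gl, if_neg this]
    simp

def bs (x : Zd d) : Set ((ℕ → Zd d) × (ℕ → Zd d)) := {p | p.1 0 = x ∧ p.2 0 = x}

/-- two-sided walk from counting measure -/
noncomputable def M (P : Zd d → Measure (ℕ → Zd d)) : Measure (ℤ → Zd d) :=
  Measure.sum fun x => (((P x).prod (P x)).restrict (bs x)).map gl

lemma M_rect (P : Zd d → Measure (ℕ → Zd d)) [∀ x, IsProbabilityMeasure (P x)]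
    (x : Zd d) (A B : Set (ℕ → Zd d)) (hA : MeasurableSet A) (hB : MeasurableSet B)
    (hAx : ∀ a ∈ A, a 0 = x) (hBx : ∀ a ∈ B, a 0 = x) :
    M P {w | bk w ∈ A ∧ fw w ∈ B} = P x A * P x B := by
  have hm : MeasurableSet {w : ℤ → Zd d | bk w ∈ A ∧ fw w ∈ B} :=
    (bk_meas hA).inter (fw_meas hB)
  have key : ∀ y, ((((P y).prod (P y)).restrict (bs y)).map gl) {w | bk w ∈ A ∧ fw w ∈ B}
      = if y = x then P x A * P x B else 0 := by
    intro y
    rw [Measure.map_apply gl_meas hm, Measure.restrict_apply (gl_meas hm)]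
    have e : gl ⁻¹' {w | bk w ∈ A ∧ fw w ∈ B} ∩ bs y = if y = x then A ×ˢ B else ∅ := by
      ext p
      split_ifs with hy
      · subst hy
        simp only [Set.mem_inter_iff, Set.mem_preimage, Set.mem_setOf_eq, bs, Set.mem_prod, fw_gl]
        constructor
        · rintro ⟨⟨h1, h2⟩, h3, h4⟩
          rw [bk_gl p (h3.trans h4.symm)] at h1
          exact ⟨h1, h2⟩
        · rintro ⟨h1, h2⟩
          rw [bk_gl p ((hAx _ h1).trans (hBx _ h2).symm)]
          exact ⟨⟨h1, h2⟩, hAx _ h1, hBx _ h2⟩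
      · simp only [Set.mem_inter_iff, Set.mem_preimage, Set.mem_setOf_eq, bs, fw_gl,
          Set.mem_empty_iff_false, iff_false]
        rintro ⟨⟨h1, h2⟩, h3, h4⟩
        exact hy (h4.symm.trans (hBx _ h2))
    rw [e]
    split_ifs with hy
    · subst hy; exact Measure.prod_prod _ _
    · simp
  rw [M, Measure.sum_apply _ hm]
  simp only [key]
  rw [tsum_ite_eq]

lemma M_cyl (P : Zd d → Measure (ℕ → Zd d)) (hP : IsSRW d P) (p q : ℕ) (γ : ℤ → Zd d) :
    M P (cyl p q γ) = if ∀ k : ℤ, -(p : ℤ) ≤ k → k < q → adj (γ (k + 1)) (γ k)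
      then ((2 * d : ℝ≥0∞))⁻¹ ^ (p + q) else 0 := by
  haveI := hP.1
  rw [cyl_eq, M_rect P (γ 0) _ _ (nc_meas _ _) (nc_meas _ _)]
  · have h1 := hP.2 (γ 0) p (bk γ) (by simp [bk])
    have h2 := hP.2 (γ 0) q (fw γ) (by simp [fw])
    unfold nc
    rw [h1, h2, pow_add]
    have e : (∀ k : ℤ, -(p : ℤ) ≤ k → k < q → adj (γ (k + 1)) (γ k)) ↔
      (∀ k < p, adj (bk γ (k+1)) (bk γ k)) ∧ (∀ k < q, adj (fw γ (k+1)) (fw γ k)) := by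
      constructor
      · intro h
        refine ⟨fun k hk => ?_, fun k hk => ?_⟩
        · rw [adj_comm']
          have := h (-((k+1 : ℕ) : ℤ)) (by omega) (by omega)
          have e : -((k+1 : ℕ) : ℤ) + 1 = -(k : ℤ) := by push_cast; ring
          rw [e] at this
          exact this
        · have := h k (by omega) (by omega)
          simpa [fw] using this
      · rintro ⟨h1, h2⟩ k hk1 hk2
        rcases le_or_gt 0 k with h | h
        · obtain ⟨m, rfl⟩ := Int.eq_ofNat_of_zero_le h
          simpa [fw] using h2 m (by omega)
        · obtain ⟨m, hm⟩ := Int.eq_ofNat_of_zero_le (a := -k - 1) (by omega)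
          have : k = -((m + 1 : ℕ) : ℤ) := by push_cast; omega
          have e : -((m+1 : ℕ) : ℤ) + 1 = -(m : ℤ) := by push_cast; ring
          subst this
          rw [adj_comm', e]
          exact h1 m (by omega)
    simp only [e]
    split_ifs <;> simp_all
  · intro a ha; simpa [bk] using ha 0 (by omega)
  · intro a ha; simpa [fw] using ha 0 (by omega)

lemma M_cyl_fin (P : Zd d → Measure (ℕ → Zd d)) (hP : IsSRW d P) (p q : ℕ) (γ : ℤ → Zd d) :
    M P (cyl p q γ) ≠ ∞ := by
  haveI := hP.1
  rw [cyl_eq, M_rect P (γ 0) _ _ (nc_meas _ _) (nc_meas _ _)]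
  · exact ENNReal.mul_ne_top (measure_ne_top _ _) (measure_ne_top _ _)
  · intro a ha; simpa [bk] using ha 0 (by omega)
  · intro a ha; simpa [fw] using ha 0 (by omega)

lemma M_sh1 (P : Zd d → Measure (ℕ → Zd d)) (hP : IsSRW d P) : (M P).map (sh 1) = M P := by
  symm
  refine ext_cyl _ _ (fun a γ => ?_) (fun a γ => M_cyl_fin P hP _ _ _)
  rw [Measure.map_apply (sh_meas 1) (cyl_meas _ _ _)]
  have : sh 1 ⁻¹' (cyl (a+1) (a+1) γ) = cyl a (a+2) (sh (-1) γ) := by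
    ext w
    simp only [cyl, sh, Set.mem_preimage, Set.mem_setOf_eq]
    constructor
    · intro h k h1 h2
      have := h (k + -1) (by omega) (by omega)
      simpa using this
    · intro h k h1 h2
      have := h (k + 1) (by omega) (by omega)
      simpa using this
  rw [this, M_cyl P hP, M_cyl P hP]
  have e : (∀ k : ℤ, -((a+1 : ℕ) : ℤ) ≤ k → k < ((a+1 : ℕ) : ℤ) → adj (γ (k + 1)) (γ k)) ↔
     (∀ k : ℤ, -(a : ℤ) ≤ k → k < ((a+2 : ℕ) : ℤ) → adj (sh (-1) γ (k + 1)) (sh (-1) γ k)) := by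
    simp only [sh]
    constructor
    · intro h k h1 h2
      have := h (k + -1) (by omega) (by omega)
      rwa [show k + -1 + 1 = k + 1 + -1 by ring] at this
    · intro h k h1 h2
      have := h (k + 1) (by omega) (by omega)
      rwa [show k + 1 + 1 + -1 = k + 1 by ring, show k + 1 + -1 = k by ring] at this
  rw [if_congr e (by rw [show a + 1 + (a + 1) = a + (a+2) by ring]) rfl]

lemma M_sh (P : Zd d → Measure (ℕ → Zd d)) (hP : IsSRW d P) (k : ℤ) (E : Set (ℤ → Zd d))
    (hE : MeasurableSet E) : M P (sh k ⁻¹' E) = M P E := by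
  have hn : ∀ (n : ℕ) (E : Set (ℤ → Zd d)), MeasurableSet E → M P (sh n ⁻¹' E) = M P E := by
    intro n
    induction n with
    | zero => intro E hE; congr 1; ext w; simp [sh_zero]
    | succ n ih =>
      intro E hE
      rw [← ih E hE]
      conv_rhs => rw [← M_sh1 P hP, Measure.map_apply (sh_meas 1) (sh_meas n hE)]
      congr 1
      ext w
      simp [sh_sh]
  rcases le_total 0 k with h | h
  · obtain ⟨m, rfl⟩ := Int.eq_ofNat_of_zero_le h
    exact hn m E hE
  · obtain ⟨m, hm⟩ := Int.eq_ofNat_of_zero_le (a := -k) (by omega)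
    rw [← hn m _ (sh_meas k hE)]
    congr 1
    ext w
    simp only [Set.mem_preimage, sh_sh]
    rw [show k + (m : ℤ) = 0 by omega, sh_zero]

lemma sections (P : Zd d → Measure (ℕ → Zd d)) (hP : IsSRW d P) (S T1 T2 : Set (ℤ → Zd d))
    (hS : MeasurableSet S) (h1 : MeasurableSet T1) (h2 : MeasurableSet T2)
    (hinv : ∀ k, ∀ w ∈ S, sh k w ∈ S)
    (u1 : ∀ w ∈ S, ∃! k, sh k w ∈ T1) (u2 : ∀ w ∈ S, ∃! k, sh k w ∈ T2) :
    M P (S ∩ T1) = M P (S ∩ T2) := by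
  have dec : ∀ T T' : Set (ℤ → Zd d), MeasurableSet T → MeasurableSet T' →
      (∀ w ∈ S, ∃! k, sh k w ∈ T') →
      M P (S ∩ T) = ∑' k : ℤ, M P (S ∩ T ∩ sh k ⁻¹' T') := by
    intro T T' hT hT' u
    rw [← measure_iUnion]
    · congr 1
      ext w
      simp only [Set.mem_inter_iff, Set.mem_iUnion, Set.mem_preimage]
      constructor
      · rintro ⟨a, b⟩
        obtain ⟨k, hk, -⟩ := u w a
        exact ⟨k, ⟨a, b⟩, hk⟩
      · rintro ⟨k, h, -⟩; exact h
    · intro i j hij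
      rw [Function.onFun, Set.disjoint_left]
      rintro w ⟨⟨a, _⟩, b⟩ ⟨_, c⟩
      exact hij ((u w a).unique b c)
    · intro k
      exact (hS.inter hT).inter (sh_meas k hT')
  rw [dec T1 T2 h1 h2 u2, dec T2 T1 h2 h1 u1, ← (Equiv.neg ℤ).tsum_eq]
  congr 1
  funext k
  simp only [Equiv.neg_apply]
  rw [← M_sh P hP k _ ((hS.inter h1).inter (sh_meas (-k) h2))]
  congr 1
  ext w
  simp only [Set.mem_inter_iff, Set.mem_preimage, sh_sh, neg_add_cancel, sh_zero]
  constructor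
  · rintro ⟨⟨a, b⟩, c⟩
    refine ⟨⟨?_, c⟩, b⟩
    have := hinv (-k) _ a
    rwa [sh_sh, neg_add_cancel, sh_zero] at this
  · rintro ⟨⟨a, b⟩, c⟩
    exact ⟨⟨hinv k _ a, c⟩, b⟩

lemma good_meas : MeasurableSet (goodPath d) := by
  have : goodPath d = (⋂ n : ℤ, {w | adj (w (n+1)) (w n)}) ∩
      ⋂ A : Finset (Zd d), ⋃ N : ℕ, ⋂ n : ℤ, ⋂ _ : N < n.natAbs, {w | w n ∈ {x | x ∉ A}} := by
    ext w
    simp only [goodPath, Set.mem_inter_iff, Set.mem_iInter, Set.mem_iUnion, Set.mem_setOf_eq]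
    refine and_congr Iff.rfl (forall_congr' fun A => ?_)
    constructor
    · intro h
      obtain ⟨N, hN⟩ := (h.image Int.natAbs).bddAbove
      refine ⟨N, fun n hn hA => ?_⟩
      have := hN ⟨n, hA, rfl⟩
      omega
    · rintro ⟨N, hN⟩
      refine (Set.finite_Icc (-(N : ℤ)) N).subset fun n hn => ?_
      by_contra hc
      refine hN n ?_ hn
      simp only [Set.mem_Icc] at hc
      omega
  rw [this]
  refine (MeasurableSet.iInter fun n => meas_ev2 _ _ adj).inter ?_
  exact MeasurableSet.iInter fun A => MeasurableSet.iUnion fun N => MeasurableSet.iInter fun n =>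
    MeasurableSet.iInter fun _ => meas_ev _ _

lemma good_sh (k : ℤ) (w : ℤ → Zd d) (h : w ∈ goodPath d) : sh k w ∈ goodPath d := by
  refine ⟨fun n => ?_, fun A => ?_⟩
  · have := h.1 (n + k)
    simp only [sh]
    rwa [show n + 1 + k = n + k + 1 by ring]
  · exact (h.2 A).preimage (f := fun n => n + k) (fun a _ b _ hab => by simpa using hab)

/-- `W^0_K` -/
def W0 (K : Finset (Zd d)) : Set (ℤ → Zd d) := {w | w 0 ∈ K ∧ ∀ n : ℤ, n < 0 → w n ∉ K}

def Hit (K : Finset (Zd d)) : Set (ℤ → Zd d) := {w | ∃ n : ℤ, w n ∈ K}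

lemma W0_meas (K : Finset (Zd d)) : MeasurableSet (W0 K) := by
  unfold W0
  simp only [Set.setOf_and, Set.setOf_forall]
  exact (meas_ev 0 (K : Set (Zd d))).inter (MeasurableSet.iInter fun n =>
    MeasurableSet.iInter fun _ => meas_ev n {x | x ∉ K})

lemma Hit_meas (K : Finset (Zd d)) : MeasurableSet (Hit K) := by
  unfold Hit
  simp only [Set.setOf_exists]
  exact MeasurableSet.iUnion fun n => meas_ev n (K : Set (Zd d))

lemma first (K : Finset (Zd d)) (w : ℤ → Zd d) (hg : w ∈ goodPath d) (hh : w ∈ Hit K) :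
    ∃! k, sh k w ∈ W0 K := by
  obtain ⟨m, hm, hmin⟩ := Set.exists_min_image _ id (hg.2 K) hh
  refine ⟨m, ⟨by simpa [sh] using hm, fun n hn hc => ?_⟩, ?_⟩
  · have := hmin (n + m) hc
    simp only [id] at this
    omega
  · rintro k ⟨h1, h2⟩
    simp only [sh, zero_add] at h1 h2
    have := hmin k h1
    simp only [id] at this
    by_contra hne
    refine h2 (m - k) (by omega) ?_
    simpa using hm

/-- transversal -/
def T (d : ℕ) : Set (ℤ → Zd d) :=
  {w | (∀ n : ℤ, Encodable.encode (w 0) ≤ Encodable.encode (w n)) ∧ ∀ n : ℤ, n < 0 → w n ≠ w 0}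

lemma T_meas : MeasurableSet (T d) := by
  unfold T
  simp only [Set.setOf_and, Set.setOf_forall]
  exact (MeasurableSet.iInter fun n => meas_ev2 0 n
    (fun x y => Encodable.encode x ≤ Encodable.encode y)).inter (MeasurableSet.iInter fun n =>
    MeasurableSet.iInter fun _ => meas_ev2 n 0 (fun x y => x ≠ y))

lemma T_sec (w : ℤ → Zd d) (hg : w ∈ goodPath d) : ∃! k, sh k w ∈ T d := by
  obtain ⟨m, hm⟩ : ∃ m : ℤ, ∀ n : ℤ, Encodable.encode (w m) ≤ Encodable.encode (w n) := by
    obtain ⟨m, hm⟩ := exists_minimal_of_wellFoundedLT (fun x : ℕ => ∃ n, Encodable.encode (w n) = x)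
      ⟨_, 0, rfl⟩
    obtain ⟨n, rfl⟩ := hm.1
    exact ⟨n, fun n' => (le_total _ _).elim id (fun h => hm.2 ⟨n', rfl⟩ h)⟩
  have key : ∀ k, sh k w ∈ T d ↔ sh k w ∈ W0 {w m} := by
    intro k
    constructor
    · rintro ⟨h1, h2⟩
      have e : sh k w 0 = w m := by
        have := h1 (m - k)
        simp only [sh, sub_add_cancel, zero_add] at this ⊢
        exact Encodable.encode_injective (le_antisymm this (hm k))
      rw [e] at h2
      exact ⟨by simp [e], fun n hn => by simpa using h2 n hn⟩
    · rintro ⟨h1, h2⟩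
      simp only [Finset.mem_singleton] at h1 h2
      refine ⟨fun n => by rw [h1]; exact hm _, fun n hn => by rw [h1]; exact h2 n hn⟩
  simp only [key]
  exact first _ w hg ⟨m, by simp⟩

def pj (w : WT d) : WStar d := Quotient.mk (shiftSetoid d) w

lemma mk_meas : Measurable (pj (d := d)) := fun _ hs => hs

lemma Q_eq (P : Zd d → Measure (ℕ → Zd d)) (hP : IsSRW d P) (K : Finset (Zd d))
    (Q : Measure (WT d)) (hQ : IsQK d P K Q) :
    Q.map Subtype.val = (M P).restrict (W0 K) := by
  haveI := hP.1
  symm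
  refine ext_cyl _ _ (fun a γ => ?_) (fun a γ => ?_)
  · rw [Measure.map_apply measurable_subtype_coe (cyl_meas _ _ _),
      Measure.restrict_apply (cyl_meas _ _ _)]
    have hq := hQ (γ 0) (nc (a+1) (bk γ)) (nc (a+1) (fw γ)) (nc_meas _ _) (nc_meas _ _)
    have e1 : (Subtype.val ⁻¹' (cyl (a+1) (a+1) γ) : Set (WT d)) =
        {w : WT d | (fun n : ℕ => w.1 (-(n : ℤ))) ∈ nc (a+1) (bk γ) ∧ w.1 0 = γ 0 ∧
        (fun n : ℕ => w.1 (n : ℤ)) ∈ nc (a+1) (fw γ)} := by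
      rw [cyl_eq]
      ext w
      simp only [Set.mem_preimage, Set.mem_setOf_eq]
      constructor
      · rintro ⟨h1, h2⟩
        exact ⟨h1, by simpa [fw] using h2 0 (by omega), h2⟩
      · rintro ⟨h1, -, h2⟩
        exact ⟨h1, h2⟩
    rw [e1, hq]
    have hesc : MeasurableSet (escSet d K) := by
      unfold escSet
      simp only [Set.setOf_forall]
      exact MeasurableSet.iInter fun n => MeasurableSet.iInter fun _ => meas_ev n {x | x ∉ K}
    split_ifs with hK
    · rw [← M_rect P (γ 0) _ _ ((nc_meas _ _).inter hesc) (nc_meas _ _)]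
      · congr 1
        rw [cyl_eq]
        ext w
        simp only [Set.mem_inter_iff, Set.mem_setOf_eq]
        constructor
        · rintro ⟨⟨h1, h2⟩, h3, h4⟩
          exact ⟨⟨h1, fun n hn => h4 _ (by omega)⟩, h2⟩
        · rintro ⟨⟨h1, h3⟩, h2⟩
          refine ⟨⟨h1, h2⟩, ?_, fun n hn => ?_⟩
          · have := h2 0 (by omega)
            simp only [fw, Nat.cast_zero] at this
            rw [this]; exact hK
          · obtain ⟨m, hm⟩ := Int.eq_ofNat_of_zero_le (a := -n) (by omega)
            have := h3 m (by omega)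
            simp only [bk] at this
            rwa [show n = -(m : ℤ) by omega]
      · intro a ha; simpa [bk] using ha.1 0 (by omega)
      · intro a ha; simpa [fw] using ha 0 (by omega)
    · convert measure_empty (μ := M P)
      rw [Set.eq_empty_iff_forall_notMem]
      rintro w ⟨h1, h2, -⟩
      rw [h1 0 (by omega) (by omega)] at h2
      exact hK h2
  · exact ne_top_of_le_ne_top (M_cyl_fin P hP _ _ _) (Measure.restrict_apply_le _ _)

lemma M_W0_fin (P : Zd d → Measure (ℕ → Zd d)) (hP : IsSRW d P) (K : Finset (Zd d)) :
    M P (W0 K) ≠ ∞ := by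
  refine ne_top_of_le_ne_top ?_ (measure_mono (t := ⋃ x ∈ K, cyl 0 0 (fun _ => x)) ?_)
  · refine ne_top_of_le_ne_top ?_ (measure_biUnion_finset_le _ _)
    exact (ENNReal.sum_lt_top.2 fun x _ => (M_cyl_fin P hP _ _ _).lt_top).ne
  · rintro w ⟨h, -⟩
    simp only [Set.mem_iUnion]
    refine ⟨w 0, h, fun k h1 h2 => ?_⟩
    have : k = 0 := by push_cast at h1 h2; omega
    rw [this]

lemma pre_WstarK (K : Finset (Zd d)) :
    pj ⁻¹' (WstarK d K) = {w : WT d | w.1 ∈ Hit K} := by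
  ext w
  constructor
  · rintro ⟨v, ⟨n, hn⟩, h⟩
    obtain ⟨k, hk⟩ := Quotient.exact h
    refine ⟨n - k, ?_⟩
    rw [hk]
    simpa using hn
  · intro h
    exact ⟨w, h, rfl⟩

lemma WstarK_meas (K : Finset (Zd d)) : MeasurableSet (WstarK d K) := by
  change MeasurableSet (pj ⁻¹' (WstarK d K))
  rw [pre_WstarK]
  exact measurable_subtype_coe (Hit_meas K)

lemma cover : (⋃ x : Zd d, WstarK d {x}) = Set.univ := by
  rw [Set.eq_univ_iff_forall]
  intro q
  induction q using Quotient.inductionOn with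
  | _ w => exact Set.mem_iUnion.2 ⟨w.1 0, w, ⟨0, by simp⟩, rfl⟩

/-- the intensity measure -/
noncomputable def nu (P : Zd d → Measure (ℕ → Zd d)) : Measure (WStar d) :=
  (((M P).restrict (T d)).comap (Subtype.val : WT d → _)).map pj

lemma nu_restrict (P : Zd d → Measure (ℕ → Zd d)) (hP : IsSRW d P) (K : Finset (Zd d))
    (Q : Measure (WT d)) (hQ : IsQK d P K Q) :
    (nu P).restrict (WstarK d K) = Q.map pj := by
  ext B hB
  have hB' : MeasurableSet (pj ⁻¹' B) := hB
  have emb : MeasurableEmbedding (Subtype.val : WT d → _) :=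
    MeasurableEmbedding.subtype_coe good_meas
  set Bt : Set (ℤ → Zd d) := Subtype.val '' (pj ⁻¹' B) with hBt
  have hBtm : MeasurableSet Bt := emb.measurableSet_image.2 hB'
  have hBtg : ∀ w ∈ Bt, w ∈ goodPath d := by
    rintro _ ⟨w, -, rfl⟩; exact w.2
  have hBts : ∀ k, ∀ w ∈ Bt, sh k w ∈ Bt := by
    rintro k _ ⟨w, hw, rfl⟩
    refine ⟨⟨sh k w.1, good_sh k _ w.2⟩, ?_, rfl⟩
    have : pj ⟨sh k w.1, good_sh k _ w.2⟩ = pj w := by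
      have hr : (shiftSetoid d).r w ⟨sh k w.1, good_sh k _ w.2⟩ := ⟨k, fun n => rfl⟩
      exact (Quotient.sound hr).symm
    rw [Set.mem_preimage, this]
    exact hw
  have hQB : Q (pj ⁻¹' B) = M P (Bt ∩ W0 K) := by
    rw [← Measure.restrict_apply hBtm, ← Q_eq P hP K Q hQ,
      Measure.map_apply measurable_subtype_coe hBtm, hBt,
      Set.preimage_image_eq _ Subtype.val_injective]
  rw [Measure.restrict_apply hB, Measure.map_apply mk_meas hB, hQB, nu,
    Measure.map_apply mk_meas (hB.inter (WstarK_meas K)), emb.comap_apply,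
    Set.preimage_inter, pre_WstarK]
  have e : (Subtype.val '' (pj ⁻¹' B ∩ {w : WT d | w.1 ∈ Hit K}))
      = Bt ∩ Hit K := by
    ext w
    constructor
    · rintro ⟨v, ⟨h1, h2⟩, rfl⟩
      exact ⟨⟨v, h1, rfl⟩, h2⟩
    · rintro ⟨⟨v, h1, rfl⟩, h2⟩
      exact ⟨v, ⟨h1, h2⟩, rfl⟩
  rw [e, Measure.restrict_apply (hBtm.inter (Hit_meas K)),
    sections P hP _ (T d) (W0 K) (hBtm.inter (Hit_meas K)) T_meas (W0_meas K)]
  · congr 1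
    ext w
    constructor
    · rintro ⟨⟨a, -⟩, b⟩; exact ⟨a, b⟩
    · rintro ⟨a, b⟩; exact ⟨⟨a, 0, b.1⟩, b⟩
  · rintro k w ⟨h1, n, hn⟩
    exact ⟨hBts k w h1, n - k, by simpa [sh] using hn⟩
  · rintro w ⟨h1, -⟩
    exact T_sec w (hBtg w h1)
  · rintro w ⟨h1, h2⟩
    exact first K w (hBtg w h1) h2

end Interl

open Interl in
theorem interlacement_intensity_exists_unique
    (d : ℕ) (hd : 3 ≤ d) (P : Zd d → Measure (ℕ → Zd d)) (hP : IsSRW d P)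
    (Q : Finset (Zd d) → Measure (WT d)) (hQ : ∀ K, IsQK d P K (Q K)) :
    ∃! ν : Measure (WStar d), SigmaFinite ν ∧
      ∀ K : Finset (Zd d),
        ν.restrict (WstarK d K) = (Q K).map (Quotient.mk (shiftSetoid d)) := by
  change ∃! ν : Measure (WStar d), SigmaFinite ν ∧
      ∀ K : Finset (Zd d), ν.restrict (WstarK d K) = (Q K).map pj
  refine ⟨nu P, ⟨?_, fun K => nu_restrict P hP K _ (hQ K)⟩, ?_⟩
  · refine Measure.sigmaFinite_of_countable (S := Set.range fun x : Zd d => WstarK d {x})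
      (Set.countable_range _) ?_ ?_
    · rintro _ ⟨x, rfl⟩
      have h := congrArg (fun μ => μ Set.univ) (nu_restrict P hP {x} _ (hQ {x}))
      simp only [Measure.restrict_apply_univ] at h
      rw [h, Measure.map_apply mk_meas MeasurableSet.univ]
      have h2 := congrArg (fun μ => μ Set.univ) (Q_eq P hP {x} _ (hQ {x}))
      simp only [Measure.restrict_apply_univ] at h2
      rw [Measure.map_apply measurable_subtype_coe MeasurableSet.univ] at h2
      rw [Set.preimage_univ] at h2 ⊢
      rw [h2]
      exact (M_W0_fin P hP _).lt_top
    · rw [Set.sUnion_range]; exact cover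
  · rintro ν' ⟨-, h⟩
    refine (Measure.ext_iff_of_iUnion_eq_univ cover).2 fun x => ?_
    rw [h, nu_restrict P hP _ _ (hQ {x})]
end

section
/- (Compatibility of the measures Q_K.) Let d ≥ 3 and let K ⊆ K' be finite subsets of ℤ^d. Let Σ denote the set of finite nearest-neighbor paths σ = (σ(0),…,σ(N_σ)) in ℤ^d with σ(0) ∈ K', σ(n) ∉ K for 0 ≤ n < N_σ and σ(N_σ) ∈ K, and for σ ∈ Σ let W^0_{K',σ} = {w ∈ W^0_{K'} : w(n) = σ(n) for 0 ≤ n ≤ N_σ}. Then Σ_{σ∈Σ} (θ_{N_σ})_*(1_{W^0_{K',σ}}·Q_{K'}) = Q_K; in other words, restricting Q_{K'} to trajectories that enter K and reparametrizing time so that time 0 is the entrance time in K yields exactly Q_K. -/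
/-!
Compatibility of the measures `Q_K`: restricting `Q_{K'}` to trajectories entering `K`
and shifting time so that time `0` is the entrance time in `K` yields `Q_K`.
-/

open MeasureTheory
open scoped ENNReal

/-- The entrance time of a doubly infinite trajectory in `K` among the times `n ≥ 0`
(junk value `0` if `K` is never visited at a nonnegative time). -/
noncomputable def hitTime (d : ℕ) (K : Finset (Zd d)) (w : WT d) : ℕ :=
  sInf {n : ℕ | w.1 (n : ℤ) ∈ K}

/-- The time shift putting time `0` at the entrance time of `K`. -/
noncomputable def shiftToHit (d : ℕ) (K : Finset (Zd d)) (w : WT d) : WT d :=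
  ⟨fun n => w.1 (n + (hitTime d K w : ℤ)), by
    constructor
    · intro n
      show adj (w.1 (n + 1 + (hitTime d K w : ℤ))) (w.1 (n + (hitTime d K w : ℤ)))
      have e : n + 1 + (hitTime d K w : ℤ) = n + (hitTime d K w : ℤ) + 1 := by ring
      rw [e]
      exact w.2.1 _
    · intro A
      have h : {n : ℤ | w.1 (n + (hitTime d K w : ℤ)) ∈ A}
          = (fun n : ℤ => n + (hitTime d K w : ℤ)) ⁻¹' {n : ℤ | w.1 n ∈ A} := rfl
      rw [h]
      exact (w.2.2 A).preimage (Set.injOn_of_injective (fun a b hab => by omega))⟩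

section helpers

theorem hlp_split {α ι : Type*} [MeasurableSpace α] [MeasurableSpace ι] [Countable ι]
    [MeasurableSingletonClass ι] (μ : Measure α) (f : α → ι) (hf : Measurable f)
    (S : Set α) : μ S = ∑' i, μ (S ∩ f ⁻¹' {i}) := by
  have h := measure_iUnion (μ := μ.restrict S) (f := fun i : ι => f ⁻¹' {i})
    (fun i j hij => by
      refine Set.disjoint_left.2 fun a ha hb => hij ?_
      simp only [Set.mem_preimage, Set.mem_singleton_iff] at ha hb
      rw [← ha, ← hb])
    (fun i => hf (measurableSet_singleton i))
  have e : (⋃ i : ι, f ⁻¹' {i}) = Set.univ := by ext; simp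
  rw [e, Measure.restrict_apply_univ] at h
  rw [h]
  congr 1; ext i
  rw [Measure.restrict_apply (hf (measurableSet_singleton i)), Set.inter_comm]

theorem hlp_adj_symm {d : ℕ} {x y : Zd d} : adj x y ↔ adj y x := by
  unfold adj
  have : ∀ i, (x i - y i).natAbs = (y i - x i).natAbs := fun i => by omega
  simp only [this]

theorem hlp_ext {d : ℕ} (μ ν : Measure (ℕ → Zd d)) [IsFiniteMeasure μ] [IsFiniteMeasure ν]
    (h : ∀ (N : ℕ) (γ : ℕ → Zd d), μ {w | ∀ k ≤ N, w k = γ k} = ν {w | ∀ k ≤ N, w k = γ k}) :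
    μ = ν := by
  have key : ∀ n : ℕ, μ.map (Preorder.frestrictLe n) = ν.map (Preorder.frestrictLe n) := by
    intro n
    refine Measure.ext_of_singleton fun s => ?_
    rw [Measure.map_apply (by fun_prop) (measurableSet_singleton _),
      Measure.map_apply (by fun_prop) (measurableSet_singleton _)]
    have : (Preorder.frestrictLe n ⁻¹' {s} : Set (ℕ → Zd d)) =
        {w | ∀ k ≤ n, w k = (fun k => if hk : k ≤ n then s ⟨k, by simpa using hk⟩ else 0) k} := by
      ext w
      simp only [Set.mem_preimage, Set.mem_singleton_iff, Set.mem_ofPred_eq]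
      constructor
      · rintro rfl k hk
        simp [hk]
      · intro h
        ext1 ⟨k, hk⟩
        have hk' : k ≤ n := by simpa using hk
        have := h k hk'
        simpa [hk'] using this
    rw [this]
    exact h _ _
  have h1 : IsProjectiveLimit μ (fun I : Finset ℕ => ν.map I.restrict) := by
    rw [isProjectiveLimit_nat_iff]
    · exact key
    · exact (fun I J hJI => by
        rw [Measure.map_map (by fun_prop) (by fun_prop)]
        rfl)
  have h2 : IsProjectiveLimit ν (fun I : Finset ℕ => ν.map I.restrict) := fun I => rfl
  exact h1.unique h2

def cyl {d : ℕ} (N : ℕ) (γ : ℕ → Zd d) : Set (ℕ → Zd d) := {w | ∀ k ≤ N, w k = γ k}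

noncomputable def pw {d : ℕ} (N : ℕ) (γ : ℕ → Zd d) : ℝ≥0∞ :=
  if ∀ k < N, adj (γ (k + 1)) (γ k) then ((2 * d : ℝ≥0∞))⁻¹ ^ N else 0

theorem hlp_meas_cyl {d : ℕ} (N : ℕ) (γ : ℕ → Zd d) : MeasurableSet (cyl N γ) := by
  have : cyl N γ = ⋂ k, ⋂ (_ : k ≤ N), (fun w : ℕ → Zd d => w k) ⁻¹' {γ k} := by
    ext; simp [cyl]
  rw [this]
  exact MeasurableSet.iInter fun k => MeasurableSet.iInter fun _ =>
    (measurable_pi_apply k) (measurableSet_singleton _)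

theorem hlp_start {d : ℕ} {P : Zd d → Measure (ℕ → Zd d)} (hP : IsSRW d P) (x : Zd d) :
    P x {w | w 0 ≠ x} = 0 := by
  have := hP.1 x
  have h := hP.2 x 0 (fun _ => x) rfl
  have e : {w : ℕ → Zd d | ∀ k ≤ 0, w k = (fun _ => x) k} = {w | w 0 = x} := by
    ext w; simp
  rw [e] at h
  have hm : MeasurableSet {w : ℕ → Zd d | w 0 = x} :=
    measurableSet_eq_fun (measurable_pi_apply 0) measurable_const
  have := (prob_compl_eq_zero_iff hm (μ := P x)).2 (by simpa using h)
  exact this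

theorem hlp_cyl {d : ℕ} {P : Zd d → Measure (ℕ → Zd d)} (hP : IsSRW d P)
    (N : ℕ) (γ : ℕ → Zd d) : P (γ 0) (cyl N γ) = pw N γ := by
  have := hP.2 (γ 0) N γ rfl
  unfold cyl pw
  rw [this]

theorem hlp_pw_rev {d : ℕ} (N : ℕ) (γ : ℕ → Zd d) : pw N (fun k => γ (N - k)) = pw N γ := by
  unfold pw
  have : (∀ k < N, adj (γ (N - (k + 1))) (γ (N - k))) ↔ ∀ k < N, adj (γ (k + 1)) (γ k) := by
    constructor
    · intro h k hk
      have := h (N - (k + 1)) (by omega)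
      rw [show N - (N - (k + 1) + 1) = k by omega, show N - (N - (k + 1)) = k + 1 by omega] at this
      exact hlp_adj_symm.1 this
    · intro h k hk
      have := h (N - (k + 1)) (by omega)
      rw [show N - (k + 1) + 1 = N - k by omega] at this
      exact hlp_adj_symm.1 this
  simp only [this]

theorem hlp_pw_le {d : ℕ} {P : Zd d → Measure (ℕ → Zd d)} (hP : IsSRW d P)
    (N : ℕ) (γ : ℕ → Zd d) : pw N γ ≠ ∞ := by
  have := hP.1 (γ 0)
  rw [← hlp_cyl hP]
  exact measure_ne_top _ _

theorem hlp_meas_shift {d : ℕ} (N : ℕ) :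
    Measurable (fun (w : ℕ → Zd d) (n : ℕ) => w (N + n)) :=
  measurable_pi_iff.2 fun n => measurable_pi_apply (N + n)

theorem hlp_markov {d : ℕ} {P : Zd d → Measure (ℕ → Zd d)} (hP : IsSRW d P)
    (N : ℕ) (γ : ℕ → Zd d) (C : Set (ℕ → Zd d)) (hC : MeasurableSet C) :
    P (γ 0) (cyl N γ ∩ {w | (fun n => w (N + n)) ∈ C}) = pw N γ * P (γ N) C := by
  have := hP.1
  have key : ((P (γ 0)).restrict (cyl N γ)).map (fun w n => w (N + n)) = pw N γ • P (γ N) := by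
    have : IsFiniteMeasure (pw N γ • P (γ N)) := by
      refine ⟨?_⟩
      simp only [Measure.smul_apply, smul_eq_mul, measure_univ, mul_one]
      exact (hlp_pw_le hP N γ).lt_top
    apply hlp_ext
    intro M β
    rw [show {w : ℕ → Zd d | ∀ k ≤ M, w k = β k} = cyl M β from rfl]
    rw [Measure.map_apply (hlp_meas_shift N) (hlp_meas_cyl M β),
      Measure.restrict_apply (hlp_meas_shift N (hlp_meas_cyl M β)), Measure.smul_apply, smul_eq_mul]
    by_cases hb : β 0 = γ N
    · set δ : ℕ → Zd d := fun k => if k ≤ N then γ k else β (k - N) with hδ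
      have d1 : ∀ k, k ≤ N → δ k = γ k := fun k hk => by simp [hδ, hk]
      have d2 : ∀ k, δ (N + k) = β k := fun k => by
        by_cases hk : k = 0
        · subst hk; simp [hδ, hb]
        · have : ¬ (N + k ≤ N) := by omega
          simp [hδ, this]
      have e : (fun (w : ℕ → Zd d) n => w (N + n)) ⁻¹' cyl M β ∩ cyl N γ = cyl (N + M) δ := by
        ext w
        simp only [cyl, Set.mem_inter_iff, Set.mem_preimage, Set.mem_ofPred_eq]
        constructor
        · rintro ⟨h1, h2⟩ k hk
          by_cases hkN : k ≤ N
          · rw [d1 k hkN, h2 k hkN]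
          · have := h1 (k - N) (by omega)
            rw [← d2, show N + (k - N) = k by omega] at this
            exact this
        · intro h
          refine ⟨fun k hk => ?_, fun k hk => ?_⟩
          · rw [← d2]; exact h _ (by omega)
          · rw [← d1 k hk]; exact h _ (by omega)
      rw [e, ← d1 0 (Nat.zero_le _), hlp_cyl hP, ← hb, hlp_cyl hP]
      unfold pw
      by_cases g1 : ∀ k < N, adj (γ (k + 1)) (γ k)
      · by_cases g2 : ∀ k < M, adj (β (k + 1)) (β k)
        · rw [if_pos g1, if_pos g2, if_pos, pow_add]
          intro k hk
          by_cases hkN : k < N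
          · rw [d1 _ hkN, d1 _ hkN.le]; exact g1 k hkN
          · have := g2 (k - N) (by omega)
            rw [← d2, ← d2, show N + (k - N + 1) = k + 1 by omega,
              show N + (k - N) = k by omega] at this
            exact this
        · rw [if_neg g2, mul_zero, if_neg]
          intro h
          apply g2
          intro k hk
          rw [← d2, ← d2]
          exact h (N + k) (by omega)
      · rw [if_neg g1, zero_mul, if_neg]
        intro h
        apply g1
        intro k hk
        rw [← d1 _ hk, ← d1 _ hk.le]
        exact h k (by omega)
    · have e : (fun (w : ℕ → Zd d) n => w (N + n)) ⁻¹' cyl M β ∩ cyl N γ = ∅ := by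
        ext w
        simp only [cyl, Set.mem_inter_iff, Set.mem_preimage, Set.mem_ofPred_eq,
          Set.mem_empty_iff_false, iff_false, not_and]
        intro h1 h2
        apply hb
        rw [← h1 0 (Nat.zero_le _), ← h2 N le_rfl]; rfl
      rw [e, measure_empty]
      have : P (γ N) (cyl M β) = 0 := by
        refine measure_mono_null ?_ (hlp_start hP (γ N))
        intro w hw h0
        exact hb (by rw [← hw 0 (Nat.zero_le _), h0])
      rw [this, mul_zero]
  have h := congrArg (fun μ : Measure (ℕ → Zd d) => μ C) key
  simp only [Measure.smul_apply, smul_eq_mul] at h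
  rw [Measure.map_apply (hlp_meas_shift N) hC,
      Measure.restrict_apply (hlp_meas_shift N hC)] at h
  rw [← h, Set.inter_comm]
  rfl

/-- reversed-time path seen from time `N`. -/
def bk {d : ℕ} (N : ℕ) (w : WT d) : ℕ → Zd d := fun n => w.1 (-(n : ℤ) + N)

def fw {d : ℕ} (N : ℕ) (w : WT d) : ℕ → Zd d := fun n => w.1 ((n : ℤ) + N)

def lastSet {d : ℕ} (K K' : Finset (Zd d)) (N : ℕ) : Set (ℕ → Zd d) :=
  {ω | (∀ n, 1 ≤ n → n ≤ N → ω n ∉ K) ∧ ω N ∈ K' ∧ ∀ n, N < n → ω n ∉ K'}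

theorem hlp_meas_mem {d : ℕ} (K : Finset (Zd d)) (n : ℕ) :
    MeasurableSet {ω : ℕ → Zd d | ω n ∈ K} :=
  (measurable_pi_apply n) K.measurableSet

theorem hlp_meas_memW {d : ℕ} (K : Finset (Zd d)) (n : ℤ) :
    MeasurableSet {w : WT d | w.1 n ∈ K} :=
  ((measurable_pi_apply n).comp measurable_subtype_coe) K.measurableSet

theorem hlp_meas_esc {d : ℕ} (K : Finset (Zd d)) : MeasurableSet (escSet d K) := by
  have : escSet d K = ⋂ n : ℕ, ⋂ (_ : 1 ≤ n), {ω : ℕ → Zd d | ω n ∈ K}ᶜ := by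
    ext; simp [escSet]
  rw [this]
  exact MeasurableSet.iInter fun n => MeasurableSet.iInter fun _ => (hlp_meas_mem K n).compl

theorem hlp_meas_last {d : ℕ} (K K' : Finset (Zd d)) (N : ℕ) :
    MeasurableSet (lastSet K K' N) := by
  have : lastSet K K' N = (⋂ n : ℕ, ⋂ (_ : 1 ≤ n), ⋂ (_ : n ≤ N), {ω : ℕ → Zd d | ω n ∈ K}ᶜ) ∩
      ({ω : ℕ → Zd d | ω N ∈ K'} ∩ ⋂ n : ℕ, ⋂ (_ : N < n), {ω : ℕ → Zd d | ω n ∈ K'}ᶜ) := by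
    ext; simp [lastSet]
  rw [this]
  exact (MeasurableSet.iInter fun n => MeasurableSet.iInter fun _ => MeasurableSet.iInter fun _ =>
    (hlp_meas_mem K n).compl).inter ((hlp_meas_mem K' N).inter
      (MeasurableSet.iInter fun n => MeasurableSet.iInter fun _ => (hlp_meas_mem K' n).compl))

def cat {d : ℕ} (N : ℕ) (γ : ℕ → Zd d) (ω : ℕ → Zd d) : ℕ → Zd d :=
  fun n => if n < N then γ n else ω (n - N)

theorem hlp_meas_cat {d : ℕ} (N : ℕ) (γ : ℕ → Zd d) : Measurable (cat N γ) := by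
  refine measurable_pi_iff.2 fun n => ?_
  unfold cat
  by_cases h : n < N
  · simp only [h, if_true]; exact measurable_const
  · simp only [h, if_false]; exact measurable_pi_apply _

theorem hlp_cat {d : ℕ} (N : ℕ) (γ ω : ℕ → Zd d) (h : ω ∈ cyl N γ) :
    cat N γ (fun n => ω (N + n)) = ω := by
  funext n
  unfold cat
  by_cases hn : n < N
  · simp only [hn, if_true]; exact (h n hn.le).symm
  · simp only [hn, if_false]; congr 1; omega

theorem hlp_meas_bk {d : ℕ} (N : ℕ) : Measurable (bk (d := d) N) :=
  measurable_pi_iff.2 fun n => (measurable_pi_apply (-(n : ℤ) + N)).comp measurable_subtype_coe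

theorem hlp_meas_fw {d : ℕ} (N : ℕ) : Measurable (fw (d := d) N) :=
  measurable_pi_iff.2 fun n => (measurable_pi_apply ((n : ℤ) + N)).comp measurable_subtype_coe

/-- The piece of a trajectory. -/
theorem hlp_piece {d : ℕ} {P : Zd d → Measure (ℕ → Zd d)} (hP : IsSRW d P)
    {K K' : Finset (Zd d)} (hKK' : K ⊆ K') {Q' : Measure (WT d)} (h2 : IsQK d P K' Q')
    (N : ℕ) (x : Zd d) (hx : x ∈ K) (A B : Set (ℕ → Zd d)) (hA : MeasurableSet A)
    (hB : MeasurableSet B) (σ : ℕ → Zd d) :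
    Q' ({w | (∀ k, 1 ≤ k → k ≤ N → bk N w k ∉ K) ∧ bk N w ∈ A ∧ w.1 N = x ∧ fw N w ∈ B} ∩
      bk N ⁻¹' (cyl N σ)) = P x ((A ∩ lastSet K K' N) ∩ cyl N σ) * P x B := by
  by_cases g : σ 0 = x ∧ ∀ k, 1 ≤ k → k ≤ N → σ k ∉ K
  swap
  · have e1 : ({w : WT d | (∀ k, 1 ≤ k → k ≤ N → bk N w k ∉ K) ∧ bk N w ∈ A ∧ w.1 N = x ∧
        fw N w ∈ B} ∩ bk N ⁻¹' (cyl N σ)) = ∅ := by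
      refine Set.eq_empty_iff_forall_notMem.2 ?_
      rintro w ⟨⟨h1, -, h3, -⟩, h5⟩
      refine g ⟨?_, fun k hk hkN => ?_⟩
      · rw [← h5 0 (Nat.zero_le _), ← h3]; simp [bk]
      · rw [← h5 k hkN]; exact h1 k hk hkN
    have e2 : P x ((A ∩ lastSet K K' N) ∩ cyl N σ) = 0 := by
      refine measure_mono_null ?_ (hlp_start hP x)
      rintro w ⟨⟨-, h2⟩, h3⟩ h0
      refine g ⟨?_, fun k hk hkN => ?_⟩
      · rw [← h3 0 (Nat.zero_le _), h0]
      · rw [← h3 k hkN]; exact h2.1 k hk hkN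
    rw [e1, e2, measure_empty, zero_mul]
  obtain ⟨rfl, g⟩ := g
  have hAσ : MeasurableSet (cat N σ ⁻¹' A) := hlp_meas_cat N σ hA
  have e1 : ({w : WT d | (∀ k, 1 ≤ k → k ≤ N → bk N w k ∉ K) ∧ bk N w ∈ A ∧ w.1 N = σ 0 ∧
        fw N w ∈ B} ∩ bk N ⁻¹' (cyl N σ)) =
      {w : WT d | (fun n : ℕ => w.1 (-(n : ℤ))) ∈ cat N σ ⁻¹' A ∧ w.1 0 = σ N ∧
        (fun n : ℕ => w.1 (n : ℤ)) ∈ cyl N (fun k => σ (N - k)) ∩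
          {w | (fun n => w (N + n)) ∈ B}} := by
    ext w
    have ecat : bk N w ∈ cyl N σ → cat N σ (fun n : ℕ => w.1 (-(n : ℤ))) = bk N w := by
      intro h
      rw [← hlp_cat N σ _ h]
      congr 1; funext n
      exact congrArg w.1 (by push_cast; ring)
    have efw : (fun n : ℕ => w.1 ((N + n : ℕ) : ℤ)) = fw N w := by
      funext n; exact congrArg w.1 (by push_cast; ring)
    have ecyl : bk N w ∈ cyl N σ ↔
        (fun n : ℕ => w.1 (n : ℤ)) ∈ cyl N (fun k => σ (N - k)) := by
      constructor
      · intro h k hk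
        have := h (N - k) (by omega)
        simp only [bk] at this ⊢
        rw [← this]; exact congrArg w.1 (by omega)
      · intro h k hk
        have := h (N - k) (by omega)
        simp only [bk] at this ⊢
        rw [show N - (N - k) = k by omega] at this
        rw [← this]; exact congrArg w.1 (by omega)
    simp only [Set.mem_inter_iff, Set.mem_ofPred_eq, Set.mem_preimage]
    rw [← ecyl, efw]
    constructor
    · rintro ⟨⟨-, a2, a3, a4⟩, a5⟩
      refine ⟨by rw [ecat a5]; exact a2, ?_, a5, a4⟩
      rw [← a5 N le_rfl]; simp [bk]
    · rintro ⟨a1, a2, a3, a4⟩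
      rw [ecat a3] at a1
      refine ⟨⟨fun k hk hkN => ?_, a1, ?_, a4⟩, a3⟩
      · rw [a3 k hkN]; exact g k hk hkN
      · rw [← a3 0 (Nat.zero_le _)]; simp [bk]
  have hB2 : MeasurableSet {w : ℕ → Zd d | (fun n => w (N + n)) ∈ B} := hlp_meas_shift N hB
  rw [e1, h2 _ _ _ hAσ ((hlp_meas_cyl _ _).inter hB2)]
  by_cases gN : σ N ∈ K'
  swap
  · rw [if_neg gN]
    have : (A ∩ lastSet K K' N) ∩ cyl N σ = ∅ := by
      refine Set.eq_empty_iff_forall_notMem.2 ?_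
      rintro w ⟨⟨-, h2⟩, h3⟩
      exact gN (by rw [← h3 N le_rfl]; exact h2.2.1)
    rw [this, measure_empty, zero_mul]
  rw [if_pos gN]
  have m1 := hlp_markov hP N (fun k => σ (N - k)) B hB
  simp only [Nat.sub_zero, Nat.sub_self] at m1
  rw [m1, hlp_pw_rev]
  have e2 : (A ∩ lastSet K K' N) ∩ cyl N σ =
      cyl N σ ∩ {w | (fun n => w (N + n)) ∈ cat N σ ⁻¹' A ∩ escSet d K'} := by
    ext w
    simp only [Set.mem_inter_iff, Set.mem_ofPred_eq, Set.mem_preimage]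
    constructor
    · rintro ⟨⟨a1, a2⟩, a3⟩
      refine ⟨a3, by rw [hlp_cat N σ w a3]; exact a1, fun n hn => a2.2.2 _ (by omega)⟩
    · rintro ⟨a1, a2, a3⟩
      rw [hlp_cat N σ w a1] at a2
      refine ⟨⟨a2, fun n hn hnN => ?_, ?_, fun n hn => ?_⟩, a1⟩
      · rw [a1 n hnN]; exact g n hn hnN
      · rw [a1 N le_rfl]; exact gN
      · have := a3 (n - N) (by omega)
        simpa [show N + (n - N) = n by omega] using this
  rw [e2, hlp_markov hP N σ _ (hAσ.inter (hlp_meas_esc K'))]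
  ring

theorem hlp_N {d : ℕ} {P : Zd d → Measure (ℕ → Zd d)} (hP : IsSRW d P)
    {K K' : Finset (Zd d)} (hKK' : K ⊆ K') {Q' : Measure (WT d)} (h2 : IsQK d P K' Q')
    (N : ℕ) (x : Zd d) (hx : x ∈ K) (A B : Set (ℕ → Zd d)) (hA : MeasurableSet A)
    (hB : MeasurableSet B) :
    Q' {w | (∀ k, 1 ≤ k → k ≤ N → bk N w k ∉ K) ∧ bk N w ∈ A ∧ w.1 N = x ∧ fw N w ∈ B}
     = P x (A ∩ lastSet K K' N) * P x B := by
  let f : (ℕ → Zd d) → (Fin (N + 1) → Zd d) := fun ω k => ω k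
  have hf : Measurable f := measurable_pi_iff.2 fun k => measurable_pi_apply _
  have hpre : ∀ s : Fin (N + 1) → Zd d, f ⁻¹' {s} =
      cyl N (fun k => if hk : k < N + 1 then s ⟨k, hk⟩ else 0) := by
    intro s
    ext w
    simp only [Set.mem_preimage, Set.mem_singleton_iff, cyl, Set.mem_ofPred_eq]
    constructor
    · rintro rfl k hk
      simp [f, Nat.lt_succ_of_le hk]
    · intro h
      funext k
      have := h k (by omega)
      simpa [f, Nat.lt_succ_iff.1 k.2] using this
  rw [hlp_split Q' (f ∘ bk N) (hf.comp (hlp_meas_bk N)), hlp_split (P x) f hf,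
    ← ENNReal.tsum_mul_right]
  congr 1; funext s
  rw [Set.preimage_comp, hpre]
  exact hlp_piece hP hKK' h2 N x hx A B hA hB _

theorem hlp_hit_spec {d : ℕ} {K : Finset (Zd d)} {w : WT d} (h : ∃ n : ℕ, w.1 (n : ℤ) ∈ K)
    (N : ℕ) : hitTime d K w = N ↔ w.1 N ∈ K ∧ ∀ k < N, w.1 (k : ℤ) ∉ K := by
  have hne : {n : ℕ | w.1 (n : ℤ) ∈ K}.Nonempty := h
  unfold hitTime
  constructor
  · rintro rfl
    exact ⟨Nat.sInf_mem hne, fun k hk => Nat.notMem_of_lt_sInf hk⟩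
  · rintro ⟨h1, h2⟩
    apply le_antisymm
    · exact Nat.sInf_le h1
    · by_contra hlt
      exact h2 _ (not_le.1 hlt) (Nat.sInf_mem hne)

theorem hlp_meas_hits {d : ℕ} (K : Finset (Zd d)) :
    MeasurableSet {w : WT d | ∃ n : ℕ, w.1 (n : ℤ) ∈ K} := by
  rw [Set.ofPred_exists]
  exact MeasurableSet.iUnion fun n => hlp_meas_memW K n

theorem hlp_meas_hit {d : ℕ} (K : Finset (Zd d)) : Measurable (hitTime d K) := by
  refine measurable_to_countable' fun N => ?_
  have : hitTime d K ⁻¹' {N} =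
      ({w : WT d | ∃ n : ℕ, w.1 (n : ℤ) ∈ K} ∩
        ({w : WT d | w.1 N ∈ K} ∩ ⋂ k : ℕ, ⋂ (_ : k < N), {w : WT d | w.1 (k : ℤ) ∈ K}ᶜ)) ∪
      ({w : WT d | ∃ n : ℕ, w.1 (n : ℤ) ∈ K}ᶜ ∩ {_w : WT d | N = 0}) := by
    ext w
    by_cases h : ∃ n : ℕ, w.1 (n : ℤ) ∈ K
    · have := hlp_hit_spec h N
      simp only [Set.mem_preimage, Set.mem_singleton_iff, this]
      simp [h]
    · have h0 : hitTime d K w = 0 := by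
        unfold hitTime
        have : {n : ℕ | w.1 (n : ℤ) ∈ K} = ∅ := by
          ext n; simp only [Set.mem_ofPred_eq, Set.mem_empty_iff_false, iff_false]
          exact fun hn => h ⟨n, hn⟩
        rw [this]; simp
      simp only [Set.mem_preimage, Set.mem_singleton_iff, h0, Set.mem_union, Set.mem_inter_iff,
        Set.mem_ofPred_eq, h, false_and, false_or, Set.mem_compl_iff, not_false_eq_true, true_and]
      exact eq_comm
  rw [this]
  have h3 : MeasurableSet (⋂ k : ℕ, ⋂ (_ : k < N), {w : WT d | w.1 (k : ℤ) ∈ K}ᶜ) :=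
    MeasurableSet.iInter fun k => MeasurableSet.iInter fun _ => (hlp_meas_memW K k).compl
  exact ((hlp_meas_hits K).inter ((hlp_meas_memW K N).inter h3)).union
    ((hlp_meas_hits K).compl.inter (MeasurableSet.const _))

theorem hlp_meas_sh {d : ℕ} (K : Finset (Zd d)) : Measurable (shiftToHit d K) := by
  refine Measurable.subtype_mk (measurable_pi_iff.2 fun n => ?_)
  have h : Measurable (fun p : WT d × ℕ => p.1.1 (n + (p.2 : ℤ))) :=
    measurable_from_prod_countable_left fun m =>
      (measurable_pi_apply (n + (m : ℤ))).comp measurable_subtype_coe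
  exact h.comp (measurable_id.prodMk (hlp_meas_hit K))

theorem hlp_decomp {d : ℕ} {P : Zd d → Measure (ℕ → Zd d)} (hP : IsSRW d P)
    {K K' : Finset (Zd d)} (hKK' : K ⊆ K') {Q : Measure (WT d)} (h1 : IsQK d P K Q)
    (x : Zd d) (hx : x ∈ K) (A : Set (ℕ → Zd d)) (hA : MeasurableSet A) :
    ∑' N, P x (A ∩ lastSet K K' N) = P x (A ∩ escSet d K) := by
  have := hP.1 x
  rw [← measure_iUnion]
  · rw [← Set.inter_iUnion]
    let I : Set (ℕ → Zd d) := {ω | ∀ m : ℕ, ∃ n, m < n ∧ ω n ∈ K'}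
    have hI : MeasurableSet I := by
      have : I = ⋂ m : ℕ, ⋃ n : ℕ, ⋃ (_ : m < n), {ω : ℕ → Zd d | ω n ∈ K'} := by
        ext; simp [I]
      rw [this]
      exact MeasurableSet.iInter fun m => MeasurableSet.iUnion fun n => MeasurableSet.iUnion fun _ =>
        hlp_meas_mem K' n
    have hI0 : P x (I ∩ escSet d K) = 0 := by
      have := h1 x I Set.univ hI MeasurableSet.univ
      rw [if_pos hx, measure_univ, mul_one] at this
      rw [← this]
      convert measure_empty (μ := Q)
      refine Set.eq_empty_iff_forall_notMem.2 ?_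
      rintro w ⟨hw, -, -⟩
      have hfin := w.2.2 K'
      have hfin2 : {n : ℕ | w.1 (-(n : ℤ)) ∈ K'}.Finite :=
        hfin.preimage (f := fun n : ℕ => -(n : ℤ)) (Set.injOn_of_injective (fun a b hab => by
          simpa using hab))
      obtain ⟨m, hm⟩ := hfin2.bddAbove
      obtain ⟨n, hn, hn'⟩ := hw m
      exact absurd (hm hn') (by omega)
    apply le_antisymm
    · apply measure_mono
      rintro ω ⟨ha, hω⟩
      refine ⟨ha, fun n hn => ?_⟩
      obtain ⟨N, hN⟩ := Set.mem_iUnion.1 hω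
      by_cases hnN : n ≤ N
      · exact hN.1 n hn hnN
      · exact fun h => hN.2.2 n (by omega) (hKK' h)
    · have hsub : A ∩ escSet d K ⊆ (A ∩ ⋃ N, lastSet K K' N) ∪
          ((I ∩ escSet d K) ∪ {w | w 0 ≠ x}) := by
        rintro ω ⟨ha, he⟩
        by_cases hi : ω ∈ I
        · exact Or.inr (Or.inl ⟨hi, he⟩)
        by_cases h0 : ω 0 = x
        swap
        · exact Or.inr (Or.inr h0)
        refine Or.inl ⟨ha, Set.mem_iUnion.2 ?_⟩
        have hex : ∃ m : ℕ, ∀ n, m < n → ω n ∉ K' := by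
          by_contra hcon
          apply hi
          intro m
          by_contra hm
          exact hcon ⟨m, fun n hn hK => hm ⟨n, hn, hK⟩⟩
        classical
        refine ⟨Nat.find hex, fun n hn _ => he n hn, ?_, Nat.find_spec hex⟩
        by_cases hz : Nat.find hex = 0
        · rw [hz, h0]; exact hKK' hx
        · by_contra hnot
          refine Nat.find_min hex (m := Nat.find hex - 1) (by omega) fun n hn => ?_
          by_cases hn2 : n = Nat.find hex
          · rw [hn2]; exact hnot
          · exact Nat.find_spec hex n (by omega)
      refine (measure_mono hsub).trans ((measure_union_le _ _).trans ?_)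
      rw [measure_union_null hI0 (hlp_start hP x), add_zero]
  · intro M N hMN
    refine Set.disjoint_left.2 ?_
    rintro ω ⟨-, hM⟩ ⟨-, hN⟩
    rcases lt_or_gt_of_ne hMN with h | h
    · exact hM.2.2 _ h hN.2.1
    · exact hN.2.2 _ h hM.2.1
  · exact fun N => hA.inter (hlp_meas_last K K' N)

theorem hlp_map {d : ℕ} {P : Zd d → Measure (ℕ → Zd d)} (hP : IsSRW d P)
    {K K' : Finset (Zd d)} (hKK' : K ⊆ K') {QK QK' : Measure (WT d)} (h1 : IsQK d P K QK)
    (h2 : IsQK d P K' QK') :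
    IsQK d P K
      ((QK'.restrict {w : WT d | ∃ n : ℕ, w.1 (n : ℤ) ∈ K}).map (shiftToHit d K)) := by
  intro x A B hA hB
  have hm : MeasurableSet {w : WT d | (fun n : ℕ => w.1 (-(n : ℤ))) ∈ A ∧ w.1 0 = x ∧
        (fun n : ℕ => w.1 (n : ℤ)) ∈ B} := by
    have a1 : Measurable (fun (w : WT d) (n : ℕ) => w.1 (-(n : ℤ))) :=
      measurable_pi_iff.2 fun n => (measurable_pi_apply (-(n : ℤ))).comp measurable_subtype_coe
    have a2 : Measurable (fun (w : WT d) (n : ℕ) => w.1 (n : ℤ)) :=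
      measurable_pi_iff.2 fun n => (measurable_pi_apply (n : ℤ)).comp measurable_subtype_coe
    have a3 : Measurable (fun (w : WT d) => w.1 0) :=
      (measurable_pi_apply (0 : ℤ)).comp measurable_subtype_coe
    exact (a1 hA).inter ((a3 (measurableSet_singleton x)).inter (a2 hB))
  rw [Measure.map_apply (hlp_meas_sh K) hm, Measure.restrict_apply (hlp_meas_sh K hm)]
  by_cases hx : x ∈ K
  · rw [if_pos hx, hlp_split QK' (hitTime d K) (hlp_meas_hit K), ← hlp_decomp hP hKK' h1 x hx A hA,
      ← ENNReal.tsum_mul_right]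
    congr 1; funext N
    rw [← hlp_N hP hKK' h2 N x hx A B hA hB]
    congr 1
    ext w
    simp only [Set.mem_inter_iff, Set.mem_preimage, Set.mem_ofPred_eq, Set.mem_singleton_iff]
    have hz : (shiftToHit d K w).1 = fun n => w.1 (n + (hitTime d K w : ℤ)) := rfl
    rw [hz]
    constructor
    · rintro ⟨⟨⟨b1, b2, b3⟩, b4⟩, b5⟩
      have b6 := (hlp_hit_spec b4 N).1 b5
      rw [b5] at b1 b2 b3
      refine ⟨fun k hk hkN => ?_, b1, by simpa using b2, b3⟩
      have := b6.2 (N - k) (by omega)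
      simp only [bk]
      rwa [show -(k : ℤ) + N = ((N - k : ℕ) : ℤ) by omega]
    · rintro ⟨b1, b2, b3, b4⟩
      have b5 : ∃ n : ℕ, w.1 (n : ℤ) ∈ K := ⟨N, by rw [b3]; exact hx⟩
      have b6 : hitTime d K w = N := by
        rw [hlp_hit_spec b5]
        refine ⟨by rw [b3]; exact hx, fun k hk => ?_⟩
        have := b1 (N - k) (by omega) (by omega)
        simp only [bk] at this
        rwa [show -((N - k : ℕ) : ℤ) + N = (k : ℤ) by omega] at this
      rw [b6]
      exact ⟨⟨⟨b2, by simpa using b3, b4⟩, b5⟩, rfl⟩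
  · rw [if_neg hx]
    convert measure_empty (μ := QK')
    refine Set.eq_empty_iff_forall_notMem.2 ?_
    rintro w ⟨⟨-, b2, -⟩, b4⟩
    apply hx
    rw [← b2]
    have := ((hlp_hit_spec b4 _).1 rfl).1
    simpa [shiftToHit] using this

theorem hlp_unique {d : ℕ} {P : Zd d → Measure (ℕ → Zd d)} (hP : IsSRW d P)
    {K : Finset (Zd d)} {Q R : Measure (WT d)} (hQ : IsQK d P K Q) (hR : IsQK d P K R) :
    Q = R := by
  have := hP.1
  have a3 : Measurable (fun (w : WT d) => w.1 0) :=
    (measurable_pi_apply (0 : ℤ)).comp measurable_subtype_coe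
  let F : WT d → (ℕ → Zd d) × (ℕ → Zd d) :=
    fun w => (fun n : ℕ => w.1 (-(n : ℤ)), fun n : ℕ => w.1 (n : ℤ))
  have hF : Measurable F := by
    refine Measurable.prodMk ?_ ?_
    · exact measurable_pi_iff.2 fun n =>
        (measurable_pi_apply (-(n : ℤ))).comp measurable_subtype_coe
    · exact measurable_pi_iff.2 fun n => (measurable_pi_apply (n : ℤ)).comp measurable_subtype_coe
  have hrect : ∀ S : Measure (WT d), IsQK d P K S → ∀ A B, MeasurableSet A → MeasurableSet B →
      S (F ⁻¹' (A ×ˢ B)) = ∑' x, if x ∈ K then P x (A ∩ escSet d K) * P x B else 0 := by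
    intro S hS A B hA hB
    rw [hlp_split S _ a3]
    congr 1; funext x
    rw [← hS x A B hA hB]
    congr 1
    ext w
    simp only [F, Set.mem_inter_iff, Set.mem_preimage, Set.mem_prod, Set.mem_singleton_iff,
      Set.mem_ofPred_eq]
    tauto
  have hfin : IsFiniteMeasure (Q.map F) := by
    refine ⟨?_⟩
    rw [Measure.map_apply hF MeasurableSet.univ, ← Set.univ_prod_univ,
      hrect Q hQ _ _ MeasurableSet.univ MeasurableSet.univ, tsum_eq_sum (s := K)
        (fun x hx => if_neg hx)]
    refine ENNReal.sum_lt_top.2 fun x hx => ?_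
    rw [if_pos hx]
    exact ENNReal.mul_lt_top (measure_lt_top _ _) (measure_lt_top _ _)
  have hmap : Q.map F = R.map F := by
    apply Measure.ext_prod
    intro A B hA hB
    rw [Measure.map_apply hF (hA.prod hB), Measure.map_apply hF (hA.prod hB),
      hrect Q hQ A B hA hB, hrect R hR A B hA hB]
  let G : (ℕ → Zd d) × (ℕ → Zd d) → (ℤ → Zd d) :=
    fun p n => if 0 ≤ n then p.2 n.toNat else p.1 (-n).toNat
  have hG : Measurable G := by
    refine measurable_pi_iff.2 fun n => ?_
    by_cases h : 0 ≤ n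
    · simp only [G, h, if_true]; exact (measurable_pi_apply _).comp measurable_snd
    · simp only [G, h, if_false]; exact (measurable_pi_apply _).comp measurable_fst
  have hGF : ∀ w : WT d, G (F w) = w.1 := by
    intro w
    funext n
    by_cases h : 0 ≤ n
    · simp only [G, F, h, if_true]; exact congrArg w.1 (by omega)
    · simp only [G, F, h, if_false]; exact congrArg w.1 (by omega)
  ext S hS
  obtain ⟨T, hT, rfl⟩ := hS
  have e : (Subtype.val ⁻¹' T : Set (WT d)) = F ⁻¹' (G ⁻¹' T) := by
    ext w; simp only [Set.mem_preimage, hGF]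
  rw [e, ← Measure.map_apply hF (hG hT), ← Measure.map_apply hF (hG hT), hmap]

end helpers

/-- **(1.30)/Theorem 1.1.** For `K ⊆ K'` finite, the image, under the time shift putting
time `0` at the entrance time in `K`, of the restriction of `Q_{K'}` to the trajectories
entering `K`, is exactly `Q_K`. -/
theorem QK_compatibility
    (d : ℕ) (hd : 3 ≤ d) (P : Zd d → Measure (ℕ → Zd d)) (hP : IsSRW d P)
    (K K' : Finset (Zd d)) (hKK' : K ⊆ K')
    (QK QK' : Measure (WT d)) (h1 : IsQK d P K QK) (h2 : IsQK d P K' QK') :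
    (QK'.restrict {w : WT d | ∃ n : ℕ, w.1 (n : ℤ) ∈ K}).map (shiftToHit d K) = QK := by
  exact hlp_unique hP (hlp_map hP hKK' h1 h2) h1
end

section
/- (Hitting-probability sandwich bounds.) For d ≥ 3, any finite nonempty K ⊆ ℤ^d, and any x ∈ ℤ^d: Σ_{y∈K} g(x,y) / sup_{z∈K} Σ_{y∈K} g(z,y) ≤ P_x[H_K < ∞] ≤ Σ_{y∈K} g(x,y) / inf_{z∈K} Σ_{y∈K} g(z,y). -/
open MeasureTheory
open scoped ENNReal

/-- The equilibrium measure `e_K`. -/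
noncomputable def eqm (d : ℕ) (P : Zd d → Measure (ℕ → Zd d)) (K : Finset (Zd d))
    (x : Zd d) : ℝ≥0∞ :=
  if x ∈ K then P x (escSet d K) else 0

/-- The capacity `cap(K) = Σ_x e_K(x)`. -/
noncomputable def capa (d : ℕ) (P : Zd d → Measure (ℕ → Zd d)) (K : Finset (Zd d)) : ℝ≥0∞ :=
  ∑ x ∈ K, eqm d P K x

/-- `Q` is a vacant-set law at level `u`:
`Q[Y_z = 1 for z ∈ K] = exp(−u·cap(K))` for every finite `K`. -/
def IsVacantLaw (d : ℕ) (P : Zd d → Measure (ℕ → Zd d)) (u : ℝ)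
    (Q : Measure (Zd d → Bool)) : Prop :=
  IsProbabilityMeasure Q ∧
  ∀ K : Finset (Zd d),
    Q {ω | ∀ z ∈ K, ω z = true} = ENNReal.ofReal (Real.exp (-(u * (capa d P K).toReal)))

/-- The Green function `g(x,y) = Σ_{n≥0} P_x[X_n = y]`. -/
noncomputable def green (d : ℕ) (P : Zd d → Measure (ℕ → Zd d)) (x y : Zd d) : ℝ≥0∞ :=
  ∑' n : ℕ, P x {w | w n = y}

lemma tpoly (t : ℝ) (ht : 98/100 ≤ t) :
    1 ≤ t * (1 - (t^4-1)/4 + 11/64 * (t^4-1)^2) := by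
  have h1 : 16*(t^3+2*t^2+3*t+4) ≤ 11*t*(1+t+t^2+t^3)^2 := by
    obtain ⟨a, rfl⟩ : ∃ a, t = 98/100 + a := ⟨t - 98/100, by ring⟩
    have ha : 0 ≤ a := by linarith
    have : 0 ≤ 11*(98/100 + a)*(1+(98/100 + a)+(98/100 + a)^2+(98/100 + a)^3)^2 - 16*((98/100 + a)^3+2*(98/100 + a)^2+3*(98/100 + a)+4) := by
      ring_nf
      positivity
    linarith
  have h2 : t * (1 - (t^4-1)/4 + 11/64 * (t^4-1)^2) - 1 =
      (t-1)^2 * (11*t*(1+t+t^2+t^3)^2 - 16*(t^3+2*t^2+3*t+4)) / 64 := by ring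
  have h3 : 0 ≤ (t-1)^2 * (11*t*(1+t+t^2+t^3)^2 - 16*(t^3+2*t^2+3*t+4)) / 64 := by
    have := sub_nonneg.2 h1
    positivity
  linarith

lemma onevar (u : ℝ) (hu : -(1/20) ≤ u) :
    (1+u)^(-(1/4) : ℝ) ≤ 1 - u/4 + 11/64*u^2 := by
  have hp : 0 < 1 + u := by linarith
  set t := (1+u)^((1/4) : ℝ) with ht
  have htp : 0 < t := Real.rpow_pos_of_pos hp _
  have ht4 : t^4 = 1+u := by
    rw [ht, ← Real.rpow_natCast, ← Real.rpow_mul hp.le]; norm_num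
  have htl : 98/100 ≤ t := by
    by_contra h
    push Not at h
    have : t^4 < (98/100)^4 := pow_lt_pow_left₀ h htp.le (by norm_num)
    rw [ht4] at this
    norm_num at this
    linarith
  have := tpoly t htl
  rw [ht4] at this
  rw [Real.rpow_neg hp.le, ← ht, inv_le_iff_one_le_mul₀ htp]
  calc (1:ℝ) ≤ _ := this
    _ = _ := by ring

lemma onevar' (s v : ℝ) (hs : 0 < s) (hv : -(s/20) ≤ v) :
    (s+v)^(-(1/4) : ℝ) ≤ s^(-(1/4) : ℝ) * (1 - v/s/4 + 11/64*(v/s)^2) := by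
  have e : s + v = s * (1 + v/s) := by field_simp
  have hu : -(1/20) ≤ v/s := by
    rw [le_div_iff₀ hs]; linarith
  rw [e, Real.mul_rpow hs.le (by linarith)]
  exact mul_le_mul_of_nonneg_left (onevar _ hu) (Real.rpow_nonneg hs.le _)

lemma superh (d : ℕ) (hd : 3 ≤ d) (a : Fin d → ℤ) (s : ℝ) (hs : s = ∑ i, (a i : ℝ)^2 + 400) :
    ∑ i, ((s + (1 + 2 * a i))^(-(1/4) : ℝ) + (s + (1 - 2 * a i))^(-(1/4) : ℝ))
      ≤ s^(-(1/4) : ℝ) * (2 * d - 1/(8*s)) := by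
  have hS : 0 ≤ ∑ i, (a i : ℝ)^2 := Finset.sum_nonneg fun i _ => sq_nonneg _
  have hsp : 0 < s := by linarith
  have hi : ∀ i, (a i : ℝ)^2 + 400 ≤ s := fun i => by
    have := Finset.single_le_sum (f := fun i => (a i : ℝ)^2) (fun i _ => sq_nonneg _) (Finset.mem_univ i)
    linarith
  have hF : 0 ≤ s^(-(1/4) : ℝ) := Real.rpow_nonneg hsp.le _
  calc _ ≤ ∑ i, s^(-(1/4) : ℝ) * (2 - 1/(2*s) + 11/32*(1+4*(a i:ℝ)^2)/s^2) := by
        refine Finset.sum_le_sum fun i _ => ?_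
        have h1 := onevar' s (1 + 2 * a i) hsp (by nlinarith [hi i, sq_nonneg ((a i : ℝ) + 20)])
        have h2 := onevar' s (1 - 2 * a i) hsp (by nlinarith [hi i, sq_nonneg ((a i : ℝ) - 20)])
        refine (add_le_add h1 h2).trans (le_of_eq ?_)
        field_simp
        ring
    _ = s^(-(1/4) : ℝ) * (2 * d - d/(2*s) + 11/32*(d+4*(s-400))/s^2) := by
        rw [← Finset.mul_sum, Finset.sum_add_distrib, ← Finset.sum_div, ← Finset.mul_sum,
          Finset.sum_add_distrib, ← Finset.mul_sum]
        simp only [Finset.sum_const, Finset.card_univ, Fintype.card_fin, nsmul_eq_mul]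
        rw [hs]; ring
    _ ≤ _ := by
        refine mul_le_mul_of_nonneg_left ?_ hF
        have hd' : (3:ℝ) ≤ d := by exact_mod_cast hd
        have hs4 : 400 ≤ s := by linarith
        have : 0 ≤ 2 * d - 1/(8*s) - (2 * d - d/(2*s) + 11/32*(d+4*(s-400))/s^2) := by
          have : 2 * d - 1/(8*s) - (2 * d - d/(2*s) + 11/32*(d+4*(s-400))/s^2)
            = ((d/2 - 1/8) * s - 11/32*(d+4*(s-400)))/s^2 := by
              field_simp; ring
          rw [this]
          apply div_nonneg _ (by positivity)
          nlinarith
        linarith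

noncomputable def ptr {d : ℕ} (x y : Zd d) : ℝ≥0∞ := if adj y x then (2 * d : ℝ≥0∞)⁻¹ else 0

lemma adj_cases {d : ℕ} (x y : Zd d) (h : adj y x) :
    ∃ j : Fin d × Bool, y = x + Pi.single j.1 (if j.2 then 1 else -1) := by
  unfold adj at h
  obtain ⟨i, hi⟩ : ∃ i, (y i - x i).natAbs ≠ 0 := by
    by_contra hc
    push Not at hc
    simp [hc] at h
  have h2 := Finset.add_sum_erase Finset.univ (fun i => (y i - x i).natAbs) (Finset.mem_univ i)
  simp only [h] at h2
  have h3 : ∑ j ∈ Finset.univ.erase i, (y j - x j).natAbs = 0 := by omega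
  rw [Finset.sum_eq_zero_iff] at h3
  have h4 : ∀ j, j ≠ i → y j = x j := fun j hj => by
    have := h3 j (by simp [hj]); omega
  have h5 : y i - x i = 1 ∨ y i - x i = -1 := by omega
  rcases h5 with h5 | h5
  · refine ⟨(i, true), funext fun j => ?_⟩
    by_cases hj : j = i
    · subst hj; simp; omega
    · simp [hj, h4 j hj]
  · refine ⟨(i, false), funext fun j => ?_⟩
    by_cases hj : j = i
    · subst hj; simp; omega
    · simp [hj, h4 j hj]

lemma ptr_sum_le {d : ℕ} (x : Zd d) (f : Zd d → ℝ≥0∞) :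
    ∑' y, ptr x y * f y ≤ (2 * d : ℝ≥0∞)⁻¹ *
      ∑ j : Fin d × Bool, f (x + Pi.single j.1 (if j.2 then 1 else -1)) := by
  classical
  set e : Fin d × Bool → Zd d := fun j => x + Pi.single j.1 (if j.2 then 1 else -1) with he
  rw [tsum_eq_sum (s := Finset.univ.image e)]
  · refine (Finset.sum_le_sum (g := fun y => (2 * d : ℝ≥0∞)⁻¹ * f y) fun y _ => ?_).trans ?_
    · unfold ptr
      split_ifs <;> simp
    · rw [← Finset.mul_sum]
      gcongr
      refine Finset.sum_image_le_of_nonneg ?_ 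
      intros; positivity
  · intro y hy
    unfold ptr
    rw [if_neg, zero_mul]
    intro h
    obtain ⟨j, hj⟩ := adj_cases x y h
    exact hy (by simp only [Finset.mem_image]; exact ⟨j, Finset.mem_univ _, hj.symm⟩)

noncomputable def lyap {d : ℕ} (y x : Zd d) : ℝ :=
  (∑ i, ((x i - y i : ℤ) : ℝ)^2 + 400)^(-(1/4) : ℝ)

lemma lyap_step {d : ℕ} (y x : Zd d) (i : Fin d) (b : ℤ) (hb : b = 1 ∨ b = -1) :
    lyap y (x + Pi.single i b) =
     ((∑ i, ((x i - y i : ℤ) : ℝ)^2 + 400) + (1 + 2 * (b * (x i - y i : ℤ))))^(-(1/4) : ℝ) := by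
  unfold lyap
  congr 1
  rw [← Finset.add_sum_erase Finset.univ _ (Finset.mem_univ i),
    ← Finset.add_sum_erase Finset.univ (fun i => ((x i - y i : ℤ) : ℝ)^2) (Finset.mem_univ i)]
  have : ∑ j ∈ Finset.univ.erase i, ((((x + Pi.single i b : Zd d) j) - y j : ℤ) : ℝ)^2
     = ∑ j ∈ Finset.univ.erase i, ((x j - y j : ℤ) : ℝ)^2 := by
    refine Finset.sum_congr rfl fun j hj => ?_
    simp [Finset.ne_of_mem_erase hj]
  rw [this]
  simp
  rcases hb with rfl | rfl <;> push_cast <;> ring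

lemma lyap_super {d : ℕ} (hd : 3 ≤ d) (y : Zd d) : ∃ (f : Zd d → ℝ≥0∞) (c : ℝ≥0∞),
    c ≠ 0 ∧ (∀ x, f x ≠ ⊤) ∧ ∀ x, (if x = y then c else 0) + ∑' z, ptr x z * f z ≤ f x := by
  have hd0 : (0:ℝ) < 2 * d := by
    have : (3:ℝ) ≤ d := by exact_mod_cast hd
    linarith
  have hpos : ∀ x, 0 ≤ lyap y x := fun x => Real.rpow_nonneg (by positivity) _
  refine ⟨fun x => ENNReal.ofReal (lyap y x),
    ENNReal.ofReal ((2*(d:ℝ))⁻¹ * (lyap y y * (1/(8*400)))), ?_, fun _ => ENNReal.ofReal_ne_top, ?_⟩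
  · have : 0 < lyap y y := Real.rpow_pos_of_pos (by positivity) _
    rw [ENNReal.ofReal_ne_zero_iff]
    positivity
  · intro x
    have h1 := ptr_sum_le x (fun x => ENNReal.ofReal (lyap y x))
    have h2 : (2 * d : ℝ≥0∞)⁻¹ = ENNReal.ofReal ((2*(d:ℝ))⁻¹) := by
      rw [ENNReal.ofReal_inv_of_pos hd0, ENNReal.ofReal_mul (by norm_num)]; simp
    rw [h2, ← ENNReal.ofReal_sum_of_nonneg (fun _ _ => hpos _),
      ← ENNReal.ofReal_mul (by positivity)] at h1
    have h3 : ∑ j : Fin d × Bool, lyap y (x + Pi.single j.1 (if j.2 then 1 else -1))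
        ≤ lyap y x * (2 * d - 1/(8*(∑ i, ((x i - y i : ℤ) : ℝ)^2 + 400))) := by
      refine le_trans (le_of_eq ?_) (superh d hd (fun i => x i - y i) _ rfl)
      rw [Fintype.sum_prod_type]
      refine Finset.sum_congr rfl fun i _ => ?_
      rw [Fintype.sum_bool]
      simp only [if_true, Bool.false_eq_true, if_false]
      rw [lyap_step _ _ _ _ (Or.inl rfl), lyap_step _ _ _ _ (Or.inr rfl)]
      push_cast
      ring_nf
    refine (add_le_add le_rfl h1).trans ?_
    have h4 : (if x = y then ENNReal.ofReal ((2*(d:ℝ))⁻¹ * (lyap y y * (1/(8*400)))) else 0)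
       = ENNReal.ofReal (if x = y then ((2*(d:ℝ))⁻¹ * (lyap y y * (1/(8*400)))) else 0) := by
      split_ifs <;> simp
    have h0 := hpos y
    rw [h4, ← ENNReal.ofReal_add (by split_ifs <;> positivity)
      (mul_nonneg (by positivity) (Finset.sum_nonneg fun _ _ => hpos _))]
    apply ENNReal.ofReal_le_ofReal
    have h5 : (if x = y then ((2*(d:ℝ))⁻¹ * (lyap y y * (1/(8*400)))) else (0:ℝ)) ≤
       (2*(d:ℝ))⁻¹ * (lyap y x * (1/(8*(∑ i, ((x i - y i : ℤ) : ℝ)^2 + 400)))) := by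
      split_ifs with h
      · subst h; simp
      · have := hpos x; positivity
    calc _ ≤ (2*(d:ℝ))⁻¹ * (lyap y x * (1/(8*(∑ i, ((x i - y i : ℤ) : ℝ)^2 + 400)))) +
          (2*d:ℝ)⁻¹ * (lyap y x * (2 * d - 1/(8*(∑ i, ((x i - y i : ℤ) : ℝ)^2 + 400)))) := by
            gcongr
      _ = ((2*d:ℝ)⁻¹ * (2*d)) * lyap y x := by ring
      _ = lyap y x := by rw [inv_mul_cancel₀ hd0.ne', one_mul]

def rst (d N : ℕ) (w : ℕ → Zd d) : Fin (N+1) → Zd d := fun k => w k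

lemma rst_meas (d N : ℕ) : Measurable (rst d N) :=
  measurable_pi_lambda _ fun _ => measurable_pi_apply _

def shf (d : ℕ) (w : ℕ → Zd d) : ℕ → Zd d := fun k => w (k+1)

lemma shf_meas (d : ℕ) : Measurable (shf d) :=
  measurable_pi_lambda _ fun _ => measurable_pi_apply _

lemma start {d : ℕ} {P : Zd d → Measure (ℕ → Zd d)} (hP : IsSRW d P) (x : Zd d) :
    ∀ᵐ w ∂(P x), w 0 = x := by
  have := hP.1 x
  have h := hP.2 x 0 (fun _ => x) rfl
  simp only [nonpos_iff_eq_zero, forall_eq, not_lt_zero, IsEmpty.forall_iff, implies_true, if_true, pow_zero] at h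
  have hm : MeasurableSet {w : ℕ → Zd d | w 0 = x} := measurableSet_eq_fun (measurable_pi_apply 0) measurable_const
  exact (prob_compl_eq_zero_iff hm).2 h

lemma start' {d : ℕ} {P : Zd d → Measure (ℕ → Zd d)} (hP : IsSRW d P) (x y : Zd d) (h : x ≠ y)
    (s : Set (ℕ → Zd d)) (hs : ∀ w ∈ s, w 0 = y) : P x s = 0 := by
  refine measure_mono_null ?_ (start hP x)
  intro w hw hw'
  exact h (hw'.symm.trans (hs w hw))

lemma markov_cyl {d : ℕ} {P : Zd d → Measure (ℕ → Zd d)} (hP : IsSRW d P) (x : Zd d) (N : ℕ)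
    (γ : ℕ → Zd d) : P x {w | ∀ k ≤ N, w (k+1) = γ k} =
      ∑' y, ptr x y * P y {w | ∀ k ≤ N, w k = γ k} := by
  rw [tsum_eq_single (γ 0)]
  · rw [hP.2 _ N γ rfl]
    have h1 : P x {w | ∀ k ≤ N, w (k+1) = γ k} =
        P x {w | ∀ k ≤ N+1, w k = (fun k => Nat.casesOn k x γ : ℕ → Zd d) k} := by
      apply measure_congr
      filter_upwards [start hP x] with w hw
      apply propext
      constructor
      · intro h k hk
        cases k with
        | zero => exact hw
        | succ k => exact h k (by omega)
      · intro h k hk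
        exact h (k+1) (by omega)
    rw [h1, hP.2 x (N+1) _ rfl]
    have h2 : (∀ k < N+1, adj ((fun k => Nat.casesOn k x γ : ℕ → Zd d) (k+1))
       ((fun k => Nat.casesOn k x γ : ℕ → Zd d) k)) ↔
       adj (γ 0) x ∧ ∀ k < N, adj (γ (k+1)) (γ k) := by
      constructor
      · intro h
        exact ⟨h 0 (by omega), fun k hk => h (k+1) (by omega)⟩
      · rintro ⟨h, h'⟩ k hk
        cases k with
        | zero => exact h
        | succ k => exact h' k (by omega)
    unfold ptr
    by_cases ha : adj (γ 0) x
    · by_cases hb : ∀ k < N, adj (γ (k+1)) (γ k)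
      · rw [if_pos (h2.2 ⟨ha, hb⟩), if_pos ha, if_pos hb, pow_succ, mul_comm]
      · rw [if_neg (fun h => hb (h2.1 h).2), if_neg hb, mul_zero]
    · rw [if_neg (fun h => ha (h2.1 h).1), if_neg ha, zero_mul]
  · intro y hy
    rw [start' hP y (γ 0) hy {w | ∀ k ≤ N, w k = γ k} (fun w (hw : ∀ k ≤ N, w k = γ k) => hw 0 (by omega)), mul_zero]

lemma markov {d : ℕ} {P : Zd d → Measure (ℕ → Zd d)} (hP : IsSRW d P) (x : Zd d) (N : ℕ)
    (B : Set (Fin (N+1) → Zd d)) : P x {w | rst d N (shf d w) ∈ B} =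
      ∑' y, ptr x y * P y {w | rst d N w ∈ B} := by
  have hm : ((P x).map (shf d)).map (rst d N) =
      Measure.sum (fun y => ptr x y • (P y).map (rst d N)) := by
    refine Measure.ext_of_singleton fun a => ?_
    rw [Measure.map_apply (rst_meas d N) (measurableSet_singleton a),
      Measure.map_apply (shf_meas d) (rst_meas d N (measurableSet_singleton a)),
      Measure.sum_apply _ (measurableSet_singleton a)]
    simp only [Measure.smul_apply, smul_eq_mul]
    have key : ∀ w : ℕ → Zd d, rst d N w = a ↔
        ∀ k ≤ N, w k = (fun k => if h : k < N+1 then a ⟨k, h⟩ else 0 : ℕ → Zd d) k := by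
      intro w
      constructor
      · rintro rfl k hk
        have : k < N+1 := by omega
        simp [this, rst]
      · intro h
        funext k
        have := h k (by omega)
        have hk := k.2
        simp only [hk, dif_pos] at this
        exact this
    have e1 : shf d ⁻¹' (rst d N ⁻¹' {a}) = {w | ∀ k ≤ N, w (k+1) =
        (fun k => if h : k < N+1 then a ⟨k, h⟩ else 0 : ℕ → Zd d) k} := by
      ext w; exact key (shf d w)
    have e2 : rst d N ⁻¹' {a} = {w | ∀ k ≤ N, w k =
        (fun k => if h : k < N+1 then a ⟨k, h⟩ else 0 : ℕ → Zd d) k} := by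
      ext w; exact key w
    simp_rw [Measure.map_apply (rst_meas d N) (measurableSet_singleton a)]
    rw [e1, e2]
    exact markov_cyl hP x N _
  have hB : MeasurableSet B := B.to_countable.measurableSet
  have := congrArg (fun μ => μ B) hm
  rw [Measure.map_apply (rst_meas d N) hB,
      Measure.map_apply (shf_meas d) (rst_meas d N hB), Measure.sum_apply _ hB] at this
  simp only [Measure.smul_apply, smul_eq_mul, Measure.map_apply (rst_meas d N) hB] at this
  exact this

/-- Truncated Green function. -/
noncomputable def Gn {d : ℕ} (P : Zd d → Measure (ℕ → Zd d)) (K : Finset (Zd d)) (n : ℕ) (x : Zd d) :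
    ℝ≥0∞ := ∑ k ∈ Finset.range n, P x {w | w k ∈ K}

/-- Truncated hitting probability. -/
noncomputable def hn {d : ℕ} (P : Zd d → Measure (ℕ → Zd d)) (K : Finset (Zd d)) (n : ℕ) (x : Zd d) :
    ℝ≥0∞ := P x {w | ∃ k ≤ n, w k ∈ K}

lemma zero_mem {d : ℕ} {P : Zd d → Measure (ℕ → Zd d)} (hP : IsSRW d P) (K : Finset (Zd d))
    (x : Zd d) : P x {w | w 0 ∈ K} = if x ∈ K then 1 else 0 := by
  have := hP.1 x
  split_ifs with h
  · rw [← measure_univ (μ := P x)]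
    apply measure_congr
    filter_upwards [start hP x] with w hw
    apply propext
    exact ⟨fun _ => trivial, fun _ => by show w 0 ∈ K; rwa [hw]⟩
  · refine measure_mono_null ?_ (start hP x)
    intro w hw hw'
    exact h (hw' ▸ hw)

lemma markov_one {d : ℕ} {P : Zd d → Measure (ℕ → Zd d)} (hP : IsSRW d P) (K : Finset (Zd d))
    (n : ℕ) (x : Zd d) : P x {w | w (n+1) ∈ K} = ∑' y, ptr x y * P y {w | w n ∈ K} := by
  simpa [rst, shf] using markov hP x n {a | a (Fin.last n) ∈ K}

lemma Gn_succ {d : ℕ} {P : Zd d → Measure (ℕ → Zd d)} (hP : IsSRW d P) (K : Finset (Zd d))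
    (n : ℕ) (x : Zd d) :
    Gn P K (n+1) x = (if x ∈ K then 1 else 0) + ∑' y, ptr x y * Gn P K n y := by
  unfold Gn
  rw [Finset.sum_range_succ', zero_mem hP, add_comm]
  congr 1
  simp_rw [markov_one hP, Finset.mul_sum]
  rw [Summable.tsum_finsetSum (fun _ _ => ENNReal.summable)]

lemma hn_succ {d : ℕ} {P : Zd d → Measure (ℕ → Zd d)} (hP : IsSRW d P) (K : Finset (Zd d))
    (n : ℕ) (x : Zd d) (hx : x ∉ K) :
    hn P K (n+1) x = ∑' y, ptr x y * hn P K n y := by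
  unfold hn
  have h := markov hP x n {a | ∃ k, a k ∈ K}
  have e : ∀ w : ℕ → Zd d, (∃ k, rst d n w k ∈ K) ↔ ∃ k ≤ n, w k ∈ K := by
    intro w
    constructor
    · rintro ⟨k, hk⟩; exact ⟨k, by omega, hk⟩
    · rintro ⟨k, hk, hk'⟩; exact ⟨⟨k, by omega⟩, hk'⟩
  simp only [Set.mem_ofPred_eq, e] at h
  rw [← h]
  apply measure_congr
  filter_upwards [start hP x] with w hw
  apply propext
  constructor
  · rintro ⟨k, hk, hk'⟩
    cases k with
    | zero => rw [hw] at hk'; exact absurd hk' hx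
    | succ k => exact ⟨k, by omega, hk'⟩
  · rintro ⟨k, hk, hk'⟩
    exact ⟨k+1, by omega, hk'⟩

lemma green_sum {d : ℕ} (P : Zd d → Measure (ℕ → Zd d)) (K : Finset (Zd d)) (x : Zd d) :
    ∑ y ∈ K, green d P x y = ∑' n, P x {w | w n ∈ K} := by
  unfold green
  rw [← Summable.tsum_finsetSum (fun _ _ => ENNReal.summable)]
  congr 1
  funext n
  rw [← measure_biUnion_finset]
  · congr 1
    ext w; simp
  · intro a _ b _ hab
    rw [Function.onFun, Set.disjoint_left]
    intro w h1 h2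
    exact hab (h1.symm.trans h2)
  · intro a _
    exact measurableSet_eq_fun (measurable_pi_apply n) measurable_const

lemma green_iSup {d : ℕ} (P : Zd d → Measure (ℕ → Zd d)) (K : Finset (Zd d)) (x : Zd d) :
    ∑ y ∈ K, green d P x y = ⨆ n, Gn P K n x := by
  rw [green_sum, ENNReal.tsum_eq_iSup_nat]; rfl

lemma hit_iSup {d : ℕ} (P : Zd d → Measure (ℕ → Zd d)) (K : Finset (Zd d)) (x : Zd d) :
    P x {w | ∃ n, w n ∈ K} = ⨆ n, hn P K n x := by
  unfold hn
  rw [← Monotone.measure_iUnion]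
  · congr 1
    ext w
    simp only [Set.mem_ofPred_eq, Set.mem_iUnion]
    exact ⟨fun ⟨n, h⟩ => ⟨n, n, le_rfl, h⟩, fun ⟨_, n, _, h⟩ => ⟨n, h⟩⟩
  · rintro a b hab w ⟨k, hk, h⟩
    exact ⟨k, hk.trans hab, h⟩

lemma green_ne_top {d : ℕ} (hd : 3 ≤ d) {P : Zd d → Measure (ℕ → Zd d)} (hP : IsSRW d P)
    (x y : Zd d) : green d P x y ≠ ⊤ := by
  obtain ⟨f, c, hc, hf, h⟩ := lyap_super hd y
  have key : ∀ n x, c * Gn P {y} n x ≤ f x := by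
    intro n
    induction n with
    | zero => intro x; simp [Gn]
    | succ n ih =>
      intro x
      refine le_trans ?_ (h x)
      rw [Gn_succ hP, mul_add, ← ENNReal.tsum_mul_left]
      refine add_le_add (by simp) (ENNReal.tsum_le_tsum fun z => ?_)
      rw [mul_left_comm]
      gcongr
      exact ih z
  have h1 : green d P x y = ⨆ n, Gn P {y} n x := by simpa using green_iSup P {y} x
  have h2 : c * green d P x y ≤ f x := by
    rw [h1, ENNReal.mul_iSup]; exact iSup_le fun n => key n x
  intro ht
  rw [ht, ENNReal.mul_top hc, top_le_iff] at h2
  exact hf x h2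

/-- **(1.9): hitting-probability sandwich bounds.** For finite nonempty `K` and any `x`,
`Σ_{y∈K} g(x,y) / sup_{z∈K} Σ_{y∈K} g(z,y) ≤ P_x[H_K < ∞] ≤
 Σ_{y∈K} g(x,y) / inf_{z∈K} Σ_{y∈K} g(z,y)`. -/
theorem hitting_probability_sandwich
    (d : ℕ) (hd : 3 ≤ d) (P : Zd d → Measure (ℕ → Zd d)) (hP : IsSRW d P)
    (K : Finset (Zd d)) (hK : K.Nonempty) (x : Zd d) :
    (∑ y ∈ K, green d P x y) / (⨆ z ∈ K, ∑ y ∈ K, green d P z y)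
        ≤ P x {w : ℕ → Zd d | ∃ n : ℕ, w n ∈ K}
    ∧ P x {w : ℕ → Zd d | ∃ n : ℕ, w n ∈ K}
        ≤ (∑ y ∈ K, green d P x y) / (⨅ z ∈ K, ∑ y ∈ K, green d P z y) := by
  have hm0 : ∀ z ∈ K, 1 ≤ ∑ y ∈ K, green d P z y := by
    intro z hz
    rw [green_iSup]
    refine le_trans ?_ (le_iSup _ 1)
    rw [Gn_succ hP, if_pos hz]
    exact le_self_add
  constructor
  · apply ENNReal.div_le_of_le_mul
    set M := ⨆ z ∈ K, ∑ y ∈ K, green d P z y with hM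
    have key : ∀ n x, Gn P K (n+1) x ≤ hn P K n x * M := by
      intro n
      induction n with
      | zero =>
        intro x
        by_cases hx : x ∈ K
        · have h1 : hn P K 0 x = 1 := by
            have := zero_mem hP K x
            simpa [hn, hx] using this
          rw [h1, one_mul]
          refine le_trans ?_ (le_iSup₂ (f := fun z _ => ∑ y ∈ K, green d P z y) x hx)
          rw [green_iSup]
          exact le_iSup (fun n => Gn P K n x) _
        · rw [Gn_succ hP, if_neg hx]; simp [Gn]
      | succ n ih =>
        intro x
        by_cases hx : x ∈ K
        · have h1 : 1 ≤ hn P K (n+1) x := by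
            have := zero_mem hP K x
            rw [if_pos hx] at this
            rw [← this]
            exact measure_mono fun w hw => ⟨0, by omega, hw⟩
          calc _ ≤ 1 * M := by
                rw [one_mul]
                refine le_trans ?_ (le_iSup₂ (f := fun z _ => ∑ y ∈ K, green d P z y) x hx)
                rw [green_iSup]
                exact le_iSup (fun n => Gn P K n x) _
            _ ≤ _ := by gcongr
        · rw [Gn_succ hP, if_neg hx, zero_add, hn_succ hP K n x hx, ← ENNReal.tsum_mul_right]
          refine ENNReal.tsum_le_tsum fun y => ?_
          rw [mul_assoc]
          gcongr
          exact ih y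
    rw [green_iSup, hit_iSup]
    refine iSup_le fun n => ?_
    cases n with
    | zero => simp [Gn]
    | succ n =>
      refine (key n x).trans ?_
      gcongr
      exact le_iSup (fun n => hn P K n x) n
  · set m := ⨅ z ∈ K, ∑ y ∈ K, green d P z y with hm
    have hmpos : m ≠ 0 := by
      have : 1 ≤ m := le_iInf₂ hm0
      exact (lt_of_lt_of_le zero_lt_one this).ne'
    have hmtop : m ≠ ⊤ := by
      obtain ⟨z, hz⟩ := hK
      refine ne_top_of_le_ne_top ?_ (iInf₂_le (f := fun z _ => ∑ y ∈ K, green d P z y) z hz)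
      exact ENNReal.sum_ne_top.2 fun y _ => green_ne_top hd hP z y
    rw [ENNReal.le_div_iff_mul_le (Or.inl hmpos) (Or.inl hmtop)]
    have hle1 : ∀ n x, hn P K n x ≤ 1 := fun n x => by
      have := hP.1 x
      exact prob_le_one
    have key : ∀ n x, hn P K n x * m ≤ ∑ y ∈ K, green d P x y := by
      intro n
      induction n with
      | zero =>
        intro x
        by_cases hx : x ∈ K
        · calc _ ≤ 1 * m := by gcongr; exact hle1 _ _
            _ ≤ _ := by
              rw [one_mul]
              exact iInf₂_le (f := fun z _ => ∑ y ∈ K, green d P z y) x hx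
        · have h1 : hn P K 0 x = 0 := by
            have := zero_mem hP K x
            simpa [hn, hx] using this
          rw [h1, zero_mul]; exact zero_le
      | succ n ih =>
        intro x
        by_cases hx : x ∈ K
        · calc _ ≤ 1 * m := by gcongr; exact hle1 _ _
            _ ≤ _ := by
              rw [one_mul]
              exact iInf₂_le (f := fun z _ => ∑ y ∈ K, green d P z y) x hx
        · rw [hn_succ hP K n x hx, ← ENNReal.tsum_mul_right]
          calc _ ≤ ∑' y, ptr x y * ∑ z ∈ K, green d P y z := by
                refine ENNReal.tsum_le_tsum fun y => ?_
                rw [mul_assoc]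
                gcongr
                exact ih y
            _ = ∑' n, P x {w | w (n+1) ∈ K} := by
                simp_rw [green_sum, markov_one hP, ← ENNReal.tsum_mul_left]
                rw [ENNReal.tsum_comm]
            _ ≤ _ := by
                rw [green_sum]
                exact ENNReal.tsum_comp_le_tsum_of_injective (Nat.succ_injective) (fun n => P x {w | w n ∈ K})
    rw [hit_iSup, ENNReal.iSup_mul]
    exact iSup_le fun n => key n x
end

section
/- (Translation invariance and ergodicity.) Let d ≥ 3, u ≥ 0, and let Q be a vacant-set law at level u on {0,1}^{ℤ^d}. Then Q is invariant under every translation t_x (where (t_x ω)_y = ω_{y+x} for y ∈ ℤ^d), and the measure-preserving flow (t_x)_{x∈ℤ^d} on ({0,1}^{ℤ^d}, Q) is ergodic: every measurable event invariant under all translations has Q-probability 0 or 1. -/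
open MeasureTheory
open scoped ENNReal

open Filter Topology
namespace VL

variable {d : ℕ}

def cyl (N : ℕ) (γ : ℕ → Zd d) : Set (ℕ → Zd d) := {w | ∀ k ≤ N, w k = γ k}

def shift (n : ℕ) (w : ℕ → Zd d) : ℕ → Zd d := fun k => w (n + k)

lemma meas_shift (n : ℕ) : Measurable (shift n : (ℕ → Zd d) → _) := by
  refine measurable_pi_lambda _ fun k => measurable_pi_apply _

lemma meas_coord (n : ℕ) (y : Zd d) : MeasurableSet {w : ℕ → Zd d | w n = y} := by
  have h : Measurable (fun w : ℕ → Zd d => w n) := measurable_pi_apply n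
  exact h (measurableSet_singleton y)

lemma meas_cyl (N : ℕ) (γ : ℕ → Zd d) : MeasurableSet (cyl N γ) := by
  have : cyl N γ = ⋂ k, ⋂ (_ : k ≤ N), {w | w k = γ k} := by
    ext w; simp [cyl]
  rw [this]
  exact MeasurableSet.iInter fun k => MeasurableSet.iInter fun _ => meas_coord _ _

/-- extension of a finite path -/
def ext0 (n : ℕ) (γ : Fin (n + 1) → Zd d) : ℕ → Zd d :=
  fun k => if h : k < n + 1 then γ ⟨k, h⟩ else 0

lemma coord_eq_iUnion (n : ℕ) (y : Zd d) :
    {w : ℕ → Zd d | w n = y} =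
      ⋃ γ : {γ : Fin (n + 1) → Zd d // γ (Fin.last n) = y}, cyl n (ext0 n γ.1) := by
  ext w
  simp only [Set.mem_ofPred_eq, Set.mem_iUnion, cyl]
  constructor
  · intro h
    refine ⟨⟨fun i => w i, by simpa using h⟩, fun k hk => ?_⟩
    simp [ext0, Nat.lt_succ_of_le hk]
  · rintro ⟨⟨γ, hγ⟩, h⟩
    have := h n le_rfl
    rw [this]
    refine Eq.trans ?_ hγ
    simp [ext0, Fin.last]

lemma cyl_disj (n : ℕ) (y : Zd d) :
    Pairwise (Function.onFun Disjoint
      (fun γ : {γ : Fin (n + 1) → Zd d // γ (Fin.last n) = y} => cyl n (ext0 n γ.1))) := by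
  intro γ η hne
  rw [Function.onFun, Set.disjoint_left]
  intro w h1 h2
  apply hne
  ext1; funext i
  have a := h1 i (Nat.lt_succ_iff.mp i.2)
  have b := h2 i (Nat.lt_succ_iff.mp i.2)
  rw [a] at b
  have hi := i.2
  simpa only [ext0, hi, dif_pos] using b

lemma ext_cyl (μ ν : Measure (ℕ → Zd d)) [IsFiniteMeasure μ]
    (h : ∀ N γ, μ (cyl N γ) = ν (cyl N γ)) : μ = ν := by
  refine Measure.ext_of_generateFrom_of_cover_subset
    (S := {s | ∃ N γ, s = cyl N γ}) (T := Set.range fun a : Zd d => cyl 0 (fun _ => a))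
    ?_ ?_ ?_ (Set.countable_range _) ?_ ?_ ?_
  · apply le_antisymm
    · refine iSup_le fun n => ?_
      rw [← measurable_iff_comap_le]
      refine @measurable_to_countable' _ _ _ _ (_) _ ?_
      intro y
      have := coord_eq_iUnion n y
      change MeasurableSet[MeasurableSpace.generateFrom _] {w : ℕ → Zd d | w n = y}
      rw [this]
      exact @MeasurableSet.iUnion _ _ (_) _ _ fun γ => MeasurableSpace.measurableSet_generateFrom ⟨_, _, rfl⟩
    · refine MeasurableSpace.generateFrom_le ?_
      rintro _ ⟨N, γ, rfl⟩
      exact meas_cyl _ _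
  · rintro _ ⟨N, γ, rfl⟩ _ ⟨M, η, rfl⟩ ⟨w, hw1, hw2⟩
    refine ⟨max N M, w, ?_⟩
    ext v
    constructor
    · rintro ⟨h1, h2⟩ k hk
      rcases le_max_iff.mp hk with hk | hk
      · rw [h1 k hk, hw1 k hk]
      · rw [h2 k hk, hw2 k hk]
    · intro hv
      refine ⟨fun k hk => ?_, fun k hk => ?_⟩
      · rw [hv k (hk.trans (le_max_left _ _)), hw1 k hk]
      · rw [hv k (hk.trans (le_max_right _ _)), hw2 k hk]
  · rintro _ ⟨a, rfl⟩
    exact ⟨0, _, rfl⟩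
  · rw [Set.eq_univ_iff_forall]
    intro w
    exact ⟨_, ⟨w 0, rfl⟩, by intro k hk; simp at hk; simp [hk]⟩
  · rintro _ ⟨a, rfl⟩
    exact measure_ne_top _ _
  · rintro _ ⟨N, γ, rfl⟩
    exact h N γ

section
variable {P : Zd d → Measure (ℕ → Zd d)} (hP : IsSRW d P)
include hP

lemma prob_cyl (x : Zd d) (N : ℕ) (γ : ℕ → Zd d) :
    P x (cyl N γ) = if γ 0 = x ∧ ∀ k < N, adj (γ (k + 1)) (γ k)
      then ((2 * d : ℝ≥0∞))⁻¹ ^ N else 0 := by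
  have := hP.1 x
  by_cases h : γ 0 = x
  · simp only [h, true_and]
    exact hP.2 x N γ h
  · simp only [h, false_and, if_false]
    have h0 := hP.2 x 0 (fun _ => x) rfl
    simp only [Nat.not_lt_zero, IsEmpty.forall_iff, implies_true, if_true, pow_zero] at h0
    have hm : MeasurableSet {w : ℕ → Zd d | ∀ k ≤ 0, w k = x} := meas_cyl 0 (fun _ => x)
    have h1 := (prob_compl_eq_zero_iff hm).2 h0
    refine measure_mono_null ?_ h1
    intro w hw hw'
    exact h ((hw 0 (Nat.zero_le _)).symm.trans (hw' 0 le_rfl))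

lemma markov_cyl (x : Zd d) (n : ℕ) (γ : ℕ → Zd d) {E : Set (ℕ → Zd d)} (hE : MeasurableSet E) :
    P x (cyl n γ ∩ shift n ⁻¹' E) = P x (cyl n γ) * P (γ n) E := by
  have i1 := hP.1 x
  have i2 := hP.1 (γ n)
  have key : ((P x).restrict (cyl n γ)).map (shift n) = (P x (cyl n γ)) • P (γ n) := by
    apply ext_cyl
    intro N η
    rw [Measure.map_apply (meas_shift n) (meas_cyl _ _),
      Measure.restrict_apply (meas_shift n (meas_cyl _ _)), Measure.smul_apply, smul_eq_mul]
    by_cases h : η 0 = γ n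
    · have hs : shift n ⁻¹' cyl N η ∩ cyl n γ
          = cyl (n + N) (fun k => if k ≤ n then γ k else η (k - n)) := by
        ext w
        constructor
        · rintro ⟨h1, h2⟩ k hk
          by_cases hkn : k ≤ n
          · simpa [hkn] using h2 k hkn
          · have := h1 (k - n) (by omega)
            simp only [shift] at this
            rw [show n + (k - n) = k by omega] at this
            simpa [hkn] using this
        · intro hw
          refine ⟨fun k hk => ?_, fun k hk => ?_⟩
          · have := hw (n + k) (by omega)
            simp only [shift]
            rw [this]
            beta_reduce
            rcases Nat.eq_zero_or_pos k with rfl | hk0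
            · simp [h]
            · rw [if_neg (by omega)]; congr 1; omega
          · have := hw k (by omega)
            rw [this]; simp [hk]
      rw [hs, prob_cyl hP, prob_cyl hP, prob_cyl hP]
      simp only [h, true_and, Nat.zero_le, if_true]
      have e : (∀ k < n + N, adj (if k + 1 ≤ n then γ (k+1) else η (k + 1 - n))
            (if k ≤ n then γ k else η (k - n))) ↔
          (∀ k < n, adj (γ (k + 1)) (γ k)) ∧ ∀ k < N, adj (η (k + 1)) (η k) := by
        constructor
        · intro H
          refine ⟨fun k hk => ?_, fun k hk => ?_⟩
          · have := H k (by omega)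
            rwa [if_pos (by omega), if_pos (by omega)] at this
          · have := H (n + k) (by omega)
            rw [if_neg (by omega), show n + k + 1 - n = k + 1 by omega] at this
            rcases Nat.eq_zero_or_pos k with rfl | hk0
            · simpa [h] using this
            · rwa [if_neg (by omega), show n + k - n = k by omega] at this
        · rintro ⟨H1, H2⟩ k hk
          by_cases hkn : k + 1 ≤ n
          · rw [if_pos hkn, if_pos (by omega)]; exact H1 k (by omega)
          · rw [if_neg hkn]
            have := H2 (k - n) (by omega)
            rw [show k + 1 - n = k - n + 1 by omega]
            by_cases hk' : k ≤ n
            · have : k = n := by omega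
              subst this
              simpa [h] using this
            · rwa [if_neg hk']
      simp only [e]
      split_ifs with a b c b c <;> first | (rw [pow_add]; done) | (exfalso; tauto) | simp
    · rw [prob_cyl hP (γ n)]
      simp only [h, false_and, if_false, mul_zero]
      convert measure_empty (μ := P x)
      rw [Set.eq_empty_iff_forall_notMem]
      rintro w ⟨h1, h2⟩
      exact h ((h1 0 (Nat.zero_le _)).symm.trans (h2 n le_rfl))
  have := congrArg (fun μ => μ E) key
  simp only [Measure.map_apply (meas_shift n) hE, Measure.restrict_apply (meas_shift n hE),
    Measure.smul_apply, smul_eq_mul] at this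
  rw [Set.inter_comm, this]

lemma markov (x y : Zd d) (n : ℕ) {E : Set (ℕ → Zd d)} (hE : MeasurableSet E) :
    P x ({w | w n = y} ∩ shift n ⁻¹' E) = P x {w | w n = y} * P y E := by
  rw [coord_eq_iUnion, Set.iUnion_inter, measure_iUnion _ _, measure_iUnion (cyl_disj n y)
    (fun _ => meas_cyl _ _), ← ENNReal.tsum_mul_right]
  · congr 1; funext γ
    rw [markov_cyl hP x n _ hE]
    congr 3
    refine Eq.trans ?_ γ.2
    simp [ext0, Fin.last]
  · intro γ η hne
    exact (cyl_disj n y hne).mono Set.inter_subset_left Set.inter_subset_left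
  · exact fun γ => (meas_cyl _ _).inter (meas_shift n hE)

lemma transl (x a : Zd d) : (P x).map (fun w k => w k + a) = P (x + a) := by
  have i1 := hP.1 x
  have hm : Measurable (fun (w : ℕ → Zd d) k => w k + a) :=
    measurable_pi_lambda _ fun k => (measurable_of_countable (fun z : Zd d => z + a)).comp
      (measurable_pi_apply k)
  apply ext_cyl
  intro N γ
  rw [Measure.map_apply hm (meas_cyl _ _)]
  have : (fun (w : ℕ → Zd d) k => w k + a) ⁻¹' cyl N γ = cyl N (fun k => γ k - a) := by
    ext w; simp [cyl, eq_sub_iff_add_eq]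
  rw [this, prob_cyl hP, prob_cyl hP]
  have e : (γ 0 - a = x ∧ ∀ k < N, adj (γ (k + 1) - a) (γ k - a)) ↔
      (γ 0 = x + a ∧ ∀ k < N, adj (γ (k + 1)) (γ k)) := by
    simp [adj, sub_eq_iff_eq_add]
  simp only [e]

omit hP in
lemma cof_cg : (cofinite : Filter (Zd d)).IsCountablyGenerated := by
  have : (cofinite : Filter (Zd d)).HasBasis (fun _ : Finset (Zd d) => True)
      (fun s => (s : Set (Zd d))ᶜ) := by
    refine ⟨fun t => ?_⟩
    rw [mem_cofinite]
    constructor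
    · intro h
      exact ⟨h.toFinset, trivial, by simp⟩
    · rintro ⟨s, _, hs⟩
      exact (Finset.finite_toSet s).subset (Set.compl_subset_comm.1 hs)
  exact this.isCountablyGenerated

omit hP in
lemma tsum_dct {ι : Type*} {l : Filter ι} [l.IsCountablyGenerated] {f : ι → ℕ → ℝ≥0∞}
    {g b : ℕ → ℝ≥0∞} (hb : ∑' n, b n ≠ ∞) (hf : ∀ i n, f i n ≤ b n)
    (h : ∀ n, Tendsto (fun i => f i n) l (𝓝 (g n))) :
    Tendsto (fun i => ∑' n, f i n) l (𝓝 (∑' n, g n)) := by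
  simp only [← lintegral_count]
  rw [← lintegral_count] at hb
  refine tendsto_lintegral_filter_of_dominated_convergence b ?_ ?_ hb ?_
  · exact Eventually.of_forall fun i => measurable_of_countable _
  · exact Eventually.of_forall fun i => Eventually.of_forall fun n => hf i n
  · exact Eventually.of_forall h

variable (P) in
omit hP in
/-- transition probabilities -/
def p (n : ℕ) (x y : Zd d) : ℝ≥0∞ := P x {w | w n = y}

lemma p_zero (x y : Zd d) : p P 0 x y = if y = x then 1 else 0 := by
  have : {w : ℕ → Zd d | w 0 = y} = cyl 0 (fun _ => y) := by
    ext w; simp [cyl]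
  rw [p, this, prob_cyl hP]; simp

lemma p_one (x y : Zd d) : p P 1 x y = if adj y x then ((2 * d : ℝ≥0∞))⁻¹ else 0 := by
  have := hP.1 x
  have h0 : P x {w | w 0 = x}ᶜ = 0 := by
    rw [prob_compl_eq_zero_iff (meas_coord 0 x)]
    have := p_zero hP x x
    simpa [p] using this
  have h1 : {w : ℕ → Zd d | w 1 = y} ∩ {w | w 0 = x} = cyl 1 (fun k => if k = 0 then x else y) := by
    ext w
    constructor
    · rintro ⟨h1, h2⟩ k hk
      interval_cases k
      · simpa using h2
      · simpa using h1
    · intro h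
      exact ⟨by simpa using h 1 le_rfl, by simpa using h 0 (by omega)⟩
  rw [p, ← measure_inter_conull h0, h1, prob_cyl hP]
  simp

lemma p_add (n m : ℕ) (x z : Zd d) : p P (n + m) x z = ∑' y, p P n x y * p P m y z := by
  have : {w : ℕ → Zd d | w (n + m) = z} =
      ⋃ y, ({w | w n = y} ∩ shift n ⁻¹' {w | w m = z}) := by
    ext w; simp [shift]
  rw [p, this, measure_iUnion]
  · exact tsum_congr fun y => markov hP x y n (meas_coord m z)
  · intro a b hab
    rw [Function.onFun, Set.disjoint_left]
    rintro w ⟨h1, _⟩ ⟨h2, _⟩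
    exact hab (h1.symm.trans h2)
  · exact fun y => (meas_coord n y).inter (meas_shift n (meas_coord m z))

lemma p_tot (n : ℕ) (x : Zd d) : ∑' y, p P n x y = 1 := by
  have := hP.1 x
  have h : (Set.univ : Set (ℕ → Zd d)) = ⋃ y, {w | w n = y} := by
    ext w; simp
  rw [← measure_univ (μ := P x), h, measure_iUnion]
  · rfl
  · intro a b hab
    rw [Function.onFun, Set.disjoint_left]
    intro w h1 h2
    exact hab (h1.symm.trans h2)
  · exact fun y => meas_coord n y

lemma p_symm (n : ℕ) (x y : Zd d) : p P n x y = p P n y x := by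
  induction n generalizing x y with
  | zero => rw [p_zero hP, p_zero hP]; simp only [eq_comm]
  | succ n ih =>
    rw [p_add hP n 1 x y, add_comm n 1, p_add hP 1 n y x]
    refine tsum_congr fun z => ?_
    rw [ih x z, mul_comm]
    congr 1
    rw [p_one hP, p_one hP]
    have : adj y z ↔ adj z y := by
      unfold adj
      have : ∀ i, (y i - z i).natAbs = (z i - y i).natAbs := fun i => by omega
      simp [this]
    simp only [this]

omit hP in
lemma meas_add (a : Zd d) : Measurable (fun (w : ℕ → Zd d) k => w k + a) :=
    measurable_pi_lambda _ fun k => (measurable_of_countable (fun z : Zd d => z + a)).comp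
      (measurable_pi_apply k)

lemma p_transl (n : ℕ) (x y a : Zd d) : p P n (x + a) (y + a) = p P n x y := by
  rw [p, ← transl hP x a, Measure.map_apply (meas_add a) (meas_coord _ _), p]
  congr 1
  ext w; simp

lemma p_diag (n : ℕ) (x : Zd d) : p P n x x = p P n 0 0 := by
  simpa using p_transl hP n 0 0 x

omit hP in
lemma amgm (a b : ℝ≥0∞) : 2 * (a * b) ≤ a * a + b * b := by
  have : ∀ a b : ℝ≥0∞, a ≤ b → 2 * (a * b) ≤ a * a + b * b := by
    intro a b h
    obtain ⟨c, rfl⟩ := exists_add_of_le h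
    calc 2 * (a * (a + c)) ≤ 2 * (a * (a + c)) + c * c := le_self_add
      _ = _ := by ring
  rcases le_total a b with h | h
  · exact this a b h
  · rw [mul_comm a b, add_comm]; exact this b a h

lemma p_even_le (n : ℕ) (x z : Zd d) : p P (n + n) x z ≤ p P (n + n) 0 0 := by
  have h : 2 * p P (n + n) x z ≤ 2 * p P (n + n) 0 0 := by
    calc 2 * p P (n + n) x z = ∑' y, 2 * (p P n x y * p P n z y) := by
          rw [p_add hP, ENNReal.tsum_mul_left]
          congr 2; funext y; rw [p_symm hP n y z]
      _ ≤ ∑' y, (p P n x y * p P n x y + p P n z y * p P n z y) :=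
          ENNReal.tsum_le_tsum fun y => amgm _ _
      _ = p P (n + n) x x + p P (n + n) z z := by
          rw [ENNReal.tsum_add, p_add hP, p_add hP]
          congr 2 <;> funext y
          · rw [p_symm hP n y x]
          · rw [p_symm hP n y z]
      _ = _ := by rw [p_diag hP _ x, p_diag hP _ z, two_mul]
  exact (ENNReal.mul_le_mul_iff_right (by simp) (by simp)).1 h

lemma p_odd_le (n : ℕ) (x z : Zd d) : p P (n + n + 1) x z ≤ p P (n + n) 0 0 := by
  rw [add_comm (n + n) 1, p_add hP]
  calc _ ≤ ∑' y, p P 1 x y * p P (n + n) 0 0 :=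
        ENNReal.tsum_le_tsum fun y => mul_le_mul_right (p_even_le hP n y z) _
    _ = _ := by rw [ENNReal.tsum_mul_right, p_tot hP, one_mul]

omit hP in
lemma meas_esc (K : Finset (Zd d)) : MeasurableSet (escSet d K) := by
  have : escSet d K = ⋂ n, ⋂ (_ : 1 ≤ n), ⋂ z ∈ K, {w : ℕ → Zd d | w n = z}ᶜ := by
    ext w; simp only [escSet, Set.mem_iInter, Set.mem_compl_iff, Set.mem_ofPred_eq]
    exact ⟨fun h n hn z hz e => h n hn (e ▸ hz), fun h n hn hz => h n hn _ hz rfl⟩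
  rw [this]
  exact MeasurableSet.iInter fun n => MeasurableSet.iInter fun _ =>
    Finset.measurableSet_biInter _ fun z _ => (meas_coord n z).compl

lemma green_esc : (∑' n, p P n 0 0) * P 0 (escSet d {0}) ≤ 1 := by
  have := hP.1 0
  rw [← ENNReal.tsum_mul_right]
  calc _ = ∑' n, P 0 ({w | w n = 0} ∩ shift n ⁻¹' escSet d {0}) :=
        tsum_congr fun n => (markov hP 0 0 n (meas_esc _)).symm
    _ = P 0 (⋃ n, ({w | w n = 0} ∩ shift n ⁻¹' escSet d {0})) := by
        rw [measure_iUnion]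
        · have key : ∀ n m : ℕ, n < m → Disjoint
              ({w : ℕ → Zd d | w n = 0} ∩ shift n ⁻¹' escSet d {0})
              ({w : ℕ → Zd d | w m = 0} ∩ shift m ⁻¹' escSet d {0}) := by
            intro n m h
            rw [Set.disjoint_left]
            rintro w ⟨_, h2⟩ ⟨h3, _⟩
            refine h2 (m - n) (by omega) ?_
            simp only [shift, Finset.mem_singleton]
            rw [show n + (m - n) = m by omega]
            exact h3
          intro n m hne
          rcases lt_or_gt_of_ne hne with h | h
          · exact key n m h
          · exact (key m n h).symm
        · exact fun n => (meas_coord n 0).inter (meas_shift n (meas_esc _))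
    _ ≤ 1 := prob_le_one

variable (P) in
omit hP in
noncomputable def G (x y : Zd d) : ℝ≥0∞ := ∑' n, p P n x y

lemma G_symm (x y : Zd d) : G P x y = G P y x := tsum_congr fun n => p_symm hP n x y

lemma G_transl (x y a : Zd d) : G P (x + a) (y + a) = G P x y :=
  tsum_congr fun n => p_transl hP n x y a

lemma G_tendsto (h : P 0 (escSet d {0}) ≠ 0) : Tendsto (fun y => G P 0 y) cofinite (𝓝 0) := by
  have i0 := hP.1 0
  have hfin : ∑' n, p P n 0 0 ≠ ∞ := by
    intro ht
    have := green_esc hP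
    rw [ht, ENNReal.top_mul h] at this
    simp at this
  have hb : ∑' n, p P (n / 2 + n / 2) 0 0 ≠ ∞ := by
    rw [← tsum_even_add_odd ENNReal.summable ENNReal.summable]
    have e1 : ∀ k, 2 * k / 2 + 2 * k / 2 = 2 * k := fun k => by omega
    have e2 : ∀ k, (2 * k + 1) / 2 + (2 * k + 1) / 2 = 2 * k := fun k => by omega
    simp only [e1, e2]
    have : ∑' k, p P (2 * k) 0 0 ≠ ∞ := by
      refine ne_top_of_le_ne_top hfin ?_
      exact ENNReal.tsum_comp_le_tsum_of_injective
        (f := fun k : ℕ => 2 * k) (fun a b h => by simpa using h) (fun n => p P n 0 0)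
    exact ENNReal.add_ne_top.2 ⟨this, this⟩
  have := cof_cg (d := d)
  have := tsum_dct (l := (cofinite : Filter (Zd d))) (f := fun y n => p P n 0 y) (g := fun _ => 0) hb ?_ ?_
  · simpa [G] using this
  · intro y n
    rcases Nat.even_or_odd' n with ⟨k, rfl | rfl⟩
    · have := p_even_le hP k 0 y
      rw [show 2 * k / 2 = k by omega, two_mul]
      exact this
    · have := p_odd_le hP k 0 y
      rw [show (2 * k + 1) / 2 = k by omega, two_mul]
      exact this
  · intro n
    apply ENNReal.tendsto_cofinite_zero_of_tsum_ne_top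
    rw [p_tot hP]; simp

lemma G_tendsto' (h : P 0 (escSet d {0}) ≠ 0) (a b : Zd d) :
    Tendsto (fun x => G P a (b + x)) cofinite (𝓝 0) := by
  have e : ∀ x, G P a (b + x) = G P 0 (x + (b - a)) := by
    intro x
    rw [← G_transl hP 0 _ a]
    congr 1
    · simp
    · abel
  simp only [e]
  exact (G_tendsto hP h).comp (add_left_injective (b - a)).tendsto_cofinite

omit hP in
lemma esc_mono {A B : Finset (Zd d)} (h : A ⊆ B) : escSet d B ⊆ escSet d A :=
  fun _ hw n hn ha => hw n hn (h ha)

omit hP in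
lemma esc_le (a : Zd d) (A B : Finset (Zd d)) :
    P a (escSet d A) ≤ P a (escSet d (A ∪ B)) + ∑ b ∈ B, G P a b := by
  have h : escSet d A ⊆ escSet d (A ∪ B) ∪ ⋃ b ∈ B, ⋃ n : ℕ, {w : ℕ → Zd d | w n = b} := by
    intro w hw
    by_cases hB : ∃ n, w n ∈ B
    · right
      obtain ⟨n, hn⟩ := hB
      simp only [Set.mem_iUnion]
      exact ⟨w n, hn, n, rfl⟩
    · left
      intro n hn hmem
      rcases Finset.mem_union.1 hmem with h | h
      · exact hw n hn h
      · exact hB ⟨n, h⟩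
  refine (measure_mono h).trans ((measure_union_le _ _).trans ?_)
  gcongr
  refine (measure_biUnion_finset_le _ _).trans ?_
  exact Finset.sum_le_sum fun b _ => measure_iUnion_le _

omit hP in
lemma capa_eq (K : Finset (Zd d)) : capa d P K = ∑ x ∈ K, P x (escSet d K) :=
  Finset.sum_congr rfl fun x hx => by simp [eqm, hx]

lemma capa_ne_top (K : Finset (Zd d)) : capa d P K ≠ ∞ := by
  rw [capa_eq]
  refine (ENNReal.sum_lt_top.2 fun x _ => ?_).ne
  have := hP.1 x
  exact measure_lt_top _ _

omit hP in
lemma capa_union_le (A B : Finset (Zd d)) : capa d P (A ∪ B) ≤ capa d P A + capa d P B := by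
  rw [capa_eq, capa_eq, capa_eq]
  calc _ ≤ ∑ x ∈ A, P x (escSet d (A ∪ B)) + ∑ x ∈ B, P x (escSet d (A ∪ B)) := by
        rw [← Finset.sum_union_inter]; exact le_self_add
    _ ≤ _ := by
        gcongr
        · exact esc_mono Finset.subset_union_left
        · exact esc_mono Finset.subset_union_right

omit hP in
lemma le_capa_union {A B : Finset (Zd d)} (h : Disjoint A B) :
    capa d P A + capa d P B ≤ capa d P (A ∪ B) +
      (∑ a ∈ A, ∑ b ∈ B, G P a b + ∑ b ∈ B, ∑ a ∈ A, G P b a) := by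
  rw [capa_eq, capa_eq, capa_eq, Finset.sum_union h, add_add_add_comm]
  rw [← Finset.sum_add_distrib, ← Finset.sum_add_distrib]
  gcongr with a ha b hb
  · exact esc_le a A B
  · rw [Finset.union_comm]; exact esc_le b B A

lemma esc_transl (K : Finset (Zd d)) (a x : Zd d) :
    P (a + x) (escSet d (K.image (· + x))) = P a (escSet d K) := by
  rw [← transl hP a x, Measure.map_apply (meas_add x) (meas_esc _)]
  congr 1
  ext w
  simp [escSet]

lemma capa_transl (K : Finset (Zd d)) (x : Zd d) :
    capa d P (K.image (· + x)) = capa d P K := by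
  rw [capa_eq, capa_eq, Finset.sum_image (fun a _ b _ h => add_right_cancel h)]
  exact Finset.sum_congr rfl fun a _ => esc_transl hP K a x

lemma capa_tendsto (K L : Finset (Zd d)) :
    Tendsto (fun x => capa d P (K ∪ L.image (· + x))) cofinite (𝓝 (capa d P K + capa d P L)) := by
  by_cases h : P 0 (escSet d {0}) = 0
  · have hz : ∀ K, capa d P K = 0 := by
      intro K
      rw [capa_eq]
      refine Finset.sum_eq_zero fun x hx => ?_
      refine measure_mono_null (esc_mono (Finset.singleton_subset_iff.2 hx)) ?_
      have := esc_transl hP {0} 0 x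
      simp only [Finset.image_singleton, zero_add] at this
      rw [this, h]
    simpa [hz] using tendsto_const_nhds
  · have hdisj : ∀ᶠ x in cofinite, Disjoint K (L.image (· + x)) := by
      have : ∀ᶠ x in cofinite, x ∉ ((K ×ˢ L).image fun q : Zd d × Zd d => q.1 - q.2) :=
        Set.Finite.compl_mem_cofinite (Finset.finite_toSet _)
      filter_upwards [this] with x hx
      rw [Finset.disjoint_left]
      intro a ha hb
      obtain ⟨b, hbL, rfl⟩ := Finset.mem_image.1 hb
      exact hx (Finset.mem_image.2 ⟨(b + x, b), Finset.mem_product.2 ⟨ha, hbL⟩, by simp⟩)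
    have herr : Tendsto (fun x => ∑ a ∈ K, ∑ b ∈ L, G P a (b + x) + ∑ b ∈ L, ∑ a ∈ K, G P (b + x) a)
        cofinite (𝓝 0) := by
      have h1 : Tendsto (fun x => ∑ a ∈ K, ∑ b ∈ L, G P a (b + x)) cofinite (𝓝 0) := by
        simpa using tendsto_finsetSum K fun a _ => tendsto_finsetSum L fun b _ => G_tendsto' hP h a b
      have h2 : Tendsto (fun x => ∑ b ∈ L, ∑ a ∈ K, G P (b + x) a) cofinite (𝓝 0) := by
        simp only [fun (x b a : Zd d) => G_symm hP (b + x) a]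
        simpa using tendsto_finsetSum L fun b _ => tendsto_finsetSum K fun a _ => G_tendsto' hP h a b
      simpa using h1.add h2
    have hlow := ENNReal.Tendsto.sub (tendsto_const_nhds (x := capa d P K + capa d P L)
      (f := (cofinite : Filter (Zd d)))) herr (Or.inr (by simp))
    rw [tsub_zero] at hlow
    refine tendsto_of_tendsto_of_tendsto_of_le_of_le' hlow tendsto_const_nhds ?_ ?_
    · filter_upwards [hdisj] with x hx
      rw [tsub_le_iff_right]
      have := le_capa_union (P := P) hx
      simp only [Finset.sum_image (fun (a : Zd d) _ b _ (h : a + x = b + x) => add_right_cancel h)] at this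
      rwa [capa_transl hP] at this
    · refine Eventually.of_forall fun x => ?_
      have := capa_union_le (P := P) K (L.image (· + x))
      rwa [capa_transl hP] at this
end

def ev (K : Finset (Zd d)) : Set (Zd d → Bool) := {ω | ∀ z ∈ K, ω z = true}

def tau (x : Zd d) (ω : Zd d → Bool) : Zd d → Bool := fun y => ω (y + x)

lemma meas_tau (x : Zd d) : Measurable (tau x) :=
  measurable_pi_lambda _ fun _ => measurable_pi_apply _

lemma meas_ev (K : Finset (Zd d)) : MeasurableSet (ev K) := by
  have : ev K = ⋂ z ∈ K, (fun ω : Zd d → Bool => ω z) ⁻¹' {true} := by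
    ext ω; simp [ev]
  rw [this]
  exact Finset.measurableSet_biInter _ fun z _ =>
    (measurable_pi_apply z) (measurableSet_singleton true)

lemma ev_inter (K L : Finset (Zd d)) : ev K ∩ ev L = ev (K ∪ L) := by
  ext ω
  simp only [ev, Set.mem_inter_iff, Set.mem_ofPred_eq, Finset.mem_union]
  constructor
  · rintro ⟨h1, h2⟩ z (h | h)
    · exact h1 z h
    · exact h2 z h
  · exact fun h => ⟨fun z hz => h z (Or.inl hz), fun z hz => h z (Or.inr hz)⟩

lemma tau_ev (x : Zd d) (K : Finset (Zd d)) : tau x ⁻¹' ev K = ev (K.image (· + x)) := by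
  ext ω
  simp only [ev, tau, Set.mem_preimage, Set.mem_ofPred_eq, Finset.forall_mem_image]

lemma ev_gen : (MeasurableSpace.pi : MeasurableSpace (Zd d → Bool)) =
    MeasurableSpace.generateFrom (Set.range ev) := by
  apply le_antisymm
  · refine iSup_le fun z => ?_
    rw [← measurable_iff_comap_le]
    refine @measurable_to_bool _ (_) _ ?_
    have : (fun ω : Zd d → Bool => ω z) ⁻¹' {true} = ev {z} := by
      ext ω; simp [ev]
    rw [this]
    exact MeasurableSpace.measurableSet_generateFrom ⟨_, rfl⟩
  · refine MeasurableSpace.generateFrom_le ?_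
    rintro _ ⟨K, rfl⟩
    exact meas_ev K

lemma ev_pi : IsPiSystem (Set.range (ev : Finset (Zd d) → _)) := by
  rintro _ ⟨K, rfl⟩ _ ⟨L, rfl⟩ _
  exact ⟨K ∪ L, (ev_inter K L).symm⟩

lemma ev_empty : ev (∅ : Finset (Zd d)) = Set.univ := by
  ext; simp [ev]

lemma ext_ev (μ ν : Measure (Zd d → Bool)) [IsFiniteMeasure μ]
    (h : ∀ K, μ (ev K) = ν (ev K)) : μ = ν := by
  refine ext_of_generate_finite _ ev_gen ev_pi ?_ ?_
  · rintro _ ⟨K, rfl⟩; exact h K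
  · rw [← ev_empty]; exact h ∅

section
variable {P : Zd d → Measure (ℕ → Zd d)} (hP : IsSRW d P) {u : ℝ}
  {Q : Measure (Zd d → Bool)} (hQ : IsVacantLaw d P u Q)
include hP hQ

lemma Q_inv (x : Zd d) : Q.map (tau x) = Q := by
  have := hQ.1
  apply ext_ev
  intro K
  rw [Measure.map_apply (meas_tau x) (meas_ev K), tau_ev]
  have h1 := hQ.2 K
  have h2 := hQ.2 (K.image (· + x))
  rw [capa_transl hP] at h2
  exact h2.trans h1.symm

lemma Q_tau (x : Zd d) {B : Set (Zd d → Bool)} (hB : MeasurableSet B) : Q (tau x ⁻¹' B) = Q B := by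
  rw [← Measure.map_apply (meas_tau x) hB, Q_inv hP hQ]

lemma mix_ev (K L : Finset (Zd d)) :
    Tendsto (fun x => Q (ev K ∩ tau x ⁻¹' ev L)) cofinite (𝓝 (Q (ev K) * Q (ev L))) := by
  have e : ∀ K, Q (ev K) = ENNReal.ofReal (Real.exp (-(u * (capa d P K).toReal))) := hQ.2
  simp only [tau_ev, ev_inter, e]
  rw [← ENNReal.ofReal_mul (Real.exp_nonneg _), ← Real.exp_add]
  have h := (ENNReal.tendsto_toReal (ENNReal.add_ne_top.2
    ⟨capa_ne_top hP K, capa_ne_top hP L⟩)).comp (capa_tendsto hP K L)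
  rw [ENNReal.toReal_add (capa_ne_top hP K) (capa_ne_top hP L)] at h
  have h2 := ENNReal.tendsto_ofReal ((Real.continuous_exp.tendsto _).comp (h.const_mul u).neg)
  rw [mul_add, neg_add] at h2
  exact h2

lemma mix (K : Finset (Zd d)) (B : Set (Zd d → Bool)) (hB : MeasurableSet B) :
    Tendsto (fun x => Q (ev K ∩ tau x ⁻¹' B)) cofinite (𝓝 (Q (ev K) * Q B)) := by
  have hq := hQ.1
  have := cof_cg (d := d)
  induction B, hB using MeasurableSpace.induction_on_inter ev_gen ev_pi with
  | empty => simpa using tendsto_const_nhds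
  | basic t ht =>
    obtain ⟨L, rfl⟩ := ht
    exact mix_ev hP hQ K L
  | compl t ht ih =>
    have e : ∀ x, Q (ev K ∩ tau x ⁻¹' tᶜ) = Q (ev K) - Q (ev K ∩ tau x ⁻¹' t) := by
      intro x
      rw [← measure_sdiff Set.inter_subset_left
        ((meas_ev K).inter (meas_tau x ht)).nullMeasurableSet (measure_ne_top _ _),
        Set.sdiff_self_inter, Set.preimage_compl, Set.sdiff_eq]
    simp only [e]
    rw [prob_compl_eq_one_sub ht, ENNReal.mul_sub (fun _ _ => measure_ne_top _ _), mul_one]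
    exact ENNReal.Tendsto.sub tendsto_const_nhds ih (Or.inl (measure_ne_top _ _))
  | iUnion f hd hf ih =>
    have e : ∀ x, Q (ev K ∩ tau x ⁻¹' (⋃ i, f i)) = ∑' i, Q (ev K ∩ tau x ⁻¹' f i) := by
      intro x
      rw [Set.preimage_iUnion, Set.inter_iUnion, measure_iUnion]
      · intro i j hij
        exact ((hd hij).preimage (tau x)).mono Set.inter_subset_right Set.inter_subset_right
      · exact fun i => (meas_ev K).inter (meas_tau x (hf i))
    simp only [e]
    rw [measure_iUnion hd hf, ← ENNReal.tsum_mul_left]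
    refine tsum_dct (b := fun i => Q (f i)) ?_ ?_ ih
    · rw [← measure_iUnion hd hf]; exact measure_ne_top _ _
    · intro x i
      rw [← Q_tau hP hQ x (hf i)]
      exact measure_mono Set.inter_subset_right

lemma ergodic (hd : 3 ≤ d) (A : Set (Zd d → Bool)) (hA : MeasurableSet A)
    (hinv : ∀ x, tau x ⁻¹' A = A) : Q A = 0 ∨ Q A = 1 := by
  have hq := hQ.1
  have : Nonempty (Fin d) := ⟨⟨0, by omega⟩⟩
  have hI : Infinite (Zd d) := inferInstance
  have h : ∀ K, Q (ev K ∩ A) = Q (ev K) * Q A := by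
    intro K
    have := mix hP hQ K A hA
    simp only [hinv] at this
    exact tendsto_nhds_unique tendsto_const_nhds this
  have hm : Q.restrict A = Q A • Q := by
    apply ext_ev
    intro K
    rw [Measure.restrict_apply (meas_ev K), h K, Measure.smul_apply, smul_eq_mul, mul_comm]
  have h2 := congrArg (fun μ => μ A) hm
  simp only [Measure.restrict_apply hA, Set.inter_self, Measure.smul_apply, smul_eq_mul] at h2
  by_cases h0 : Q A = 0
  · exact Or.inl h0
  · right
    have h3 : Q A * 1 = Q A * Q A := by rw [mul_one]; exact h2
    exact ((ENNReal.mul_right_inj h0 (measure_ne_top _ _)).1 h3).symm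
end
end VL

/-- **Theorem 2.1 (2.3): translation invariance and ergodicity of the vacant-set law.**
Every vacant-set law at level `u` is invariant under all translations, and the
translation flow is ergodic. -/
theorem vacant_law_translation_invariant_and_ergodic
    (d : ℕ) (hd : 3 ≤ d) (P : Zd d → Measure (ℕ → Zd d)) (hP : IsSRW d P)
    (u : ℝ) (hu : 0 ≤ u) (Q : Measure (Zd d → Bool)) (hQ : IsVacantLaw d P u Q) :
    (∀ x : Zd d, Q.map (fun ω (y : Zd d) => ω (y + x)) = Q)
    ∧ ∀ A : Set (Zd d → Bool), MeasurableSet A →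
        (∀ x : Zd d, (fun ω (y : Zd d) => ω (y + x)) ⁻¹' A = A) →
        Q A = 0 ∨ Q A = 1 := by
  exact ⟨fun x => VL.Q_inv hP hQ x, fun A hA hinv => VL.ergodic hP hQ hd A hA hinv⟩
end

section
/- (Zero-one law for percolation of the vacant set.) Let d ≥ 3, u ≥ 0, and let Q be a vacant-set law at level u on {0,1}^{ℤ^d}. Let Perc be the event that the set {x ∈ ℤ^d : Y_x = 1} has an infinite nearest-neighbor connected component, and let η(u) = Q[0 belongs to an infinite nearest-neighbor connected component of {x : Y_x = 1}]. Then Q[Perc] is 0 or 1, and Q[Perc] = 1 if and only if η(u) > 0. -/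
open MeasureTheory
open scoped ENNReal

/-- `x` and `y` are connected by a nearest-neighbor path inside `S`. -/
def connectedIn {d : ℕ} (S : Set (Zd d)) (x y : Zd d) : Prop :=
  ∃ (n : ℕ) (γ : ℕ → Zd d), γ 0 = x ∧ γ n = y ∧ (∀ k ≤ n, γ k ∈ S) ∧
    ∀ k < n, adj (γ (k + 1)) (γ k)

open Filter Topology

namespace VP

variable {d : ℕ}

def cyl (N : ℕ) (γ : ℕ → Zd d) : Set (ℕ → Zd d) := {w | ∀ k ≤ N, w k = γ k}

def restr (n : ℕ) (w : ℕ → Zd d) : Fin (n + 1) → Zd d := fun i => w i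

def ext (n : ℕ) (f : Fin (n + 1) → Zd d) : ℕ → Zd d := fun k => f ⟨min k n, by omega⟩

def shift (n : ℕ) (w : ℕ → Zd d) : ℕ → Zd d := fun k => w (n + k)

lemma restr_meas (n : ℕ) : Measurable (restr (d := d) n) :=
  measurable_pi_lambda _ fun _ => measurable_pi_apply _

lemma shift_meas (n : ℕ) : Measurable (shift (d := d) n) :=
  measurable_pi_lambda _ fun _ => measurable_pi_apply _

lemma restr_pre (n : ℕ) (f : Fin (n + 1) → Zd d) : restr n ⁻¹' {f} = cyl n (ext n f) := by
  ext w
  simp only [Set.mem_preimage, Set.mem_singleton_iff, cyl, Set.mem_ofPred_eq, ext]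
  constructor
  · rintro rfl k hk
    simp [restr, hk]
  · intro h
    funext i
    have := h i (by omega)
    simp only [restr, this]
    congr 1
    ext
    simp; omega

lemma cyl_meas (N : ℕ) (γ : ℕ → Zd d) : MeasurableSet (cyl N γ) := by
  have : cyl N γ = ⋂ k, ⋂ (_ : k ≤ N), (fun w : ℕ → Zd d => w k) ⁻¹' {γ k} := by
    ext w; simp [cyl]
  rw [this]
  exact MeasurableSet.iInter fun k => MeasurableSet.iInter fun _ =>
    (measurable_pi_apply k) (measurableSet_singleton _)

lemma cyl_pi : IsPiSystem {S : Set (ℕ → Zd d) | ∃ N γ, S = cyl N γ} := by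
  rintro _ ⟨N, γ, rfl⟩ _ ⟨M, δ, rfl⟩ ⟨w, h1, h2⟩
  refine ⟨max N M, w, ?_⟩
  ext v
  simp only [cyl, Set.mem_inter_iff, Set.mem_ofPred_eq] at *
  constructor
  · rintro ⟨a, b⟩ k hk
    rcases le_max_iff.1 hk with h | h
    · rw [a k h, h1 k h]
    · rw [b k h, h2 k h]
  · intro h
    exact ⟨fun k hk => by rw [h k (by omega), h1 k hk], fun k hk => by rw [h k (by omega), h2 k hk]⟩

lemma cyl_gen : (inferInstance : MeasurableSpace (ℕ → Zd d)) =
    MeasurableSpace.generateFrom {S : Set (ℕ → Zd d) | ∃ N γ, S = cyl N γ} := by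
  apply le_antisymm
  · refine iSup_le fun k => ?_
    rw [← measurable_iff_comap_le]
    refine @measurable_to_countable _ _ _ _ (MeasurableSpace.generateFrom _) _ fun w => ?_
    have : (fun b : ℕ → Zd d => b k) ⁻¹' {w k} =
        ⋃ (f : {f : Fin (k + 1) → Zd d // f (Fin.last k) = w k}), cyl k (ext k f.1) := by
      ext v
      simp only [Set.mem_preimage, Set.mem_singleton_iff, Set.mem_iUnion, ← restr_pre]
      constructor
      · intro h
        exact ⟨⟨restr k v, by simpa [restr] using h⟩, rfl⟩
      · rintro ⟨⟨f, hf⟩, rfl⟩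
        simpa [restr] using hf
    rw [this]
    exact MeasurableSet.iUnion fun f => MeasurableSpace.measurableSet_generateFrom ⟨_, _, rfl⟩
  · refine MeasurableSpace.generateFrom_le ?_
    rintro _ ⟨N, γ, rfl⟩
    exact cyl_meas N γ

lemma path_ext (μ ν : Measure (ℕ → Zd d)) [IsFiniteMeasure μ]
    (h : ∀ N γ, μ (cyl N γ) = ν (cyl N γ)) (hu : μ Set.univ = ν Set.univ) : μ = ν := by
  refine ext_of_generate_finite _ cyl_gen cyl_pi ?_ hu
  rintro _ ⟨N, γ, rfl⟩
  exact h N γ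

section
variable {P : Zd d → Measure (ℕ → Zd d)} (hP : IsSRW d P)
include hP

lemma cylP (x : Zd d) (N : ℕ) (γ : ℕ → Zd d) : P x (cyl N γ) =
    if γ 0 = x ∧ ∀ k < N, adj (γ (k + 1)) (γ k) then ((2 * d : ℝ≥0∞))⁻¹ ^ N else 0 := by
  by_cases h : γ 0 = x
  · simp only [h, true_and]
    exact hP.2 x N γ h
  · simp only [h, false_and, if_false]
    have := hP.1 x
    have h0 := hP.2 x 0 (fun _ => x) rfl
    have h1 : P x (cyl 0 (fun _ => x))ᶜ = 0 := by
      rw [prob_compl_eq_zero_iff (cyl_meas 0 (fun _ => x))]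
      exact h0.trans (by simp)
    refine measure_mono_null ?_ h1
    intro w hw hc
    exact h ((hw 0 (by omega)).symm.trans (hc 0 le_rfl))

lemma sym (φ : Zd d ≃ Zd d) (hφ : ∀ a b, adj (φ a) (φ b) ↔ adj a b) (x : Zd d)
    (S : Set (ℕ → Zd d)) (hS : MeasurableSet S) :
    P (φ x) S = P x {w | (fun k => φ (w k)) ∈ S} := by
  have := hP.1
  have hm : Measurable (fun (w : ℕ → Zd d) k => φ (w k)) :=
    measurable_pi_lambda _ fun k => (measurable_of_countable φ).comp (measurable_pi_apply k)
  have : P (φ x) = (P x).map (fun w k => φ (w k)) := by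
    refine path_ext _ _ (fun N γ => ?_) ?_
    · rw [Measure.map_apply hm (cyl_meas _ _)]
      have : (fun (w : ℕ → Zd d) k => φ (w k)) ⁻¹' cyl N γ = cyl N (fun k => φ.symm (γ k)) := by
        ext w
        simp [cyl, Equiv.eq_symm_apply]
      rw [this, cylP hP, cylP hP]
      refine if_congr (and_congr ?_ (forall_congr' fun k => forall_congr' fun _ => ?_)) rfl rfl
      · rw [Equiv.symm_apply_eq]
      · rw [← hφ (φ.symm _)]; simp
    · rw [Measure.map_apply hm MeasurableSet.univ]
      simp
  rw [this, Measure.map_apply hm hS]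
  rfl

lemma markov_cyl (x : Zd d) (n : ℕ) (γ : ℕ → Zd d) (B : Set (ℕ → Zd d)) (hB : MeasurableSet B) :
    P x (cyl n γ ∩ shift n ⁻¹' B) = P x (cyl n γ) * P (γ n) B := by
  have := hP.1
  have key : ((P x).restrict (cyl n γ)).map (shift n) = P x (cyl n γ) • P (γ n) := by
    have : IsFiniteMeasure (((P x).restrict (cyl n γ)).map (shift n)) := inferInstance
    refine path_ext _ _ (fun M δ => ?_) ?_
    · rw [Measure.map_apply (shift_meas n) (cyl_meas _ _),
        Measure.restrict_apply (shift_meas n (cyl_meas _ _)), Measure.smul_apply, smul_eq_mul]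
      by_cases h : δ 0 = γ n
      · have : shift n ⁻¹' cyl M δ ∩ cyl n γ =
            cyl (n + M) (fun k => if k ≤ n then γ k else δ (k - n)) := by
          ext w
          simp only [cyl, shift, Set.mem_inter_iff, Set.mem_preimage, Set.mem_ofPred_eq]
          constructor
          · rintro ⟨a, b⟩ k hk
            split_ifs with hkn
            · exact b k hkn
            · have := a (k - n) (by omega)
              rwa [show n + (k - n) = k by omega] at this
          · intro hw
            constructor
            · intro k hk
              have := hw (n + k) (by omega)
              rw [this]
              split_ifs with hkn
              · have : k = 0 := by omega
                subst this
                simp [h]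
              · congr 1; omega
            · intro k hk
              have := hw k (by omega)
              rwa [if_pos hk] at this
        rw [this, cylP hP, cylP hP, cylP hP]
        have hiff : ((if 0 ≤ n then γ 0 else δ (0 - n)) = x ∧ ∀ k < n + M,
            adj (if k + 1 ≤ n then γ (k+1) else δ (k + 1 - n)) (if k ≤ n then γ k else δ (k - n)))
            ↔ (γ 0 = x ∧ ∀ k < n, adj (γ (k + 1)) (γ k)) ∧
              (δ 0 = γ n ∧ ∀ k < M, adj (δ (k + 1)) (δ k)) := by
          simp only [Nat.zero_le, if_true, h, true_and, and_assoc]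
          refine and_congr_right fun _ => ?_
          constructor
          · intro H
            constructor
            · intro k hk
              have := H k (by omega)
              rwa [if_pos (by omega), if_pos (by omega)] at this
            · intro k hk
              have := H (n + k) (by omega)
              rw [if_neg (by omega), show n + k + 1 - n = k + 1 by omega] at this
              split_ifs at this with hh
              · have : k = 0 := by omega
                subst this
                rw [h]; simpa using this
              · rwa [show n + k - n = k by omega] at this
          · rintro ⟨H1, H2⟩ k hk
            by_cases hkn : k < n
            · rw [if_pos (by omega), if_pos (by omega)]; exact H1 k hkn
            · rw [if_neg (by omega), show k + 1 - n = (k - n) + 1 by omega]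
              have := H2 (k - n) (by omega)
              split_ifs with hh
              · have hk : k = n := by omega
                subst hk
                rw [← h]; simpa using this
              · exact this
        rw [if_congr hiff rfl rfl]
        by_cases h1 : γ 0 = x ∧ ∀ k < n, adj (γ (k + 1)) (γ k) <;>
        by_cases h2 : δ 0 = γ n ∧ ∀ k < M, adj (δ (k + 1)) (δ k)
        · rw [if_pos ⟨h1, h2⟩, if_pos h1, if_pos h2, pow_add]
        · rw [if_neg (fun c => h2 c.2), if_neg h2, mul_zero]
        · rw [if_neg (fun c => h1 c.1), if_neg h1, zero_mul]
        · rw [if_neg (fun c => h1 c.1), if_neg h1, zero_mul]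
      · rw [cylP hP (γ n), if_neg (fun c => h c.1), mul_zero]
        convert measure_empty (μ := P x)
        ext w
        simp only [cyl, shift, Set.mem_inter_iff, Set.mem_preimage, Set.mem_ofPred_eq,
          Set.mem_empty_iff_false, iff_false, not_and]
        intro a b
        exact h ((a 0 (by omega)).symm.trans (b n le_rfl))
    · rw [Measure.map_apply (shift_meas n) MeasurableSet.univ]
      simp
  have := congrArg (fun μ => μ B) key
  simp only [Measure.smul_apply, smul_eq_mul] at this
  rw [← this, Measure.map_apply (shift_meas n) hB, Measure.restrict_apply (shift_meas n hB),
    Set.inter_comm]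

lemma markov (x z : Zd d) (n : ℕ) (T : Set (Fin (n + 1) → Zd d)) (hT : ∀ f ∈ T, f (Fin.last n) = z)
    (B : Set (ℕ → Zd d)) (hB : MeasurableSet B) :
    P x (restr n ⁻¹' T ∩ shift n ⁻¹' B) = P x (restr n ⁻¹' T) * P z B := by
  have h1 := tsum_measure_preimage_singleton (μ := (P x).restrict (shift n ⁻¹' B)) (f := restr n)
    (Set.to_countable T) (fun y _ => restr_meas n (measurableSet_singleton y))
  have h2 := tsum_measure_preimage_singleton (μ := P x) (f := restr n)
    (Set.to_countable T) (fun y _ => restr_meas n (measurableSet_singleton y))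
  rw [Measure.restrict_apply (restr_meas n (Set.to_countable T).measurableSet)] at h1
  rw [← h1, ← h2, ← ENNReal.tsum_mul_right]
  refine tsum_congr fun f => ?_
  rw [Measure.restrict_apply (restr_meas n (measurableSet_singleton _)), restr_pre,
    markov_cyl hP x n _ B hB]
  congr 2
  rw [← hT f f.2]
  simp [ext, Fin.last]

def hit (z : Zd d) : Set (ℕ → Zd d) := {w | ∃ n, w n = z}

omit hP in
lemma at_meas (n : ℕ) (z : Zd d) : MeasurableSet {w : ℕ → Zd d | w n = z} :=
  measurableSet_eq_fun (measurable_pi_apply n) measurable_const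

omit hP in
lemma hit_meas (z : Zd d) : MeasurableSet (hit z) := by
  have : hit z = ⋃ n, {w : ℕ → Zd d | w n = z} := by ext w; simp [hit]
  rw [this]
  exact MeasurableSet.iUnion fun n => at_meas n z

omit hP in
lemma esc_meas (K : Finset (Zd d)) : MeasurableSet (escSet d K) := by
  have : escSet d K = ⋂ n : ℕ, ⋂ (_ : 1 ≤ n), (fun w : ℕ → Zd d => w n) ⁻¹' ((K : Set (Zd d))ᶜ) := by
    ext w; simp [escSet]
  rw [this]
  exact MeasurableSet.iInter fun n => MeasurableSet.iInter fun _ =>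
    (measurable_pi_apply n) (Set.to_countable _).measurableSet

omit hP in
lemma adj_add (x a b : Zd d) : adj (a + x) (b + x) ↔ adj a b := by
  simp [adj]

omit hP in
lemma adj_sub (x a b : Zd d) : adj (x - a) (x - b) ↔ adj a b := by
  unfold adj
  have : ∀ i, ((x - a) i - (x - b) i).natAbs = (a i - b i).natAbs := by
    intro i; simp only [Pi.sub_apply]; omega
  simp only [this]

lemma esc_trans (x y : Zd d) (K : Finset (Zd d)) :
    P (y + x) (escSet d (K.image (· + x))) = P y (escSet d K) := by
  have := sym hP (Equiv.addRight x) (fun a b => adj_add x a b) y _ (esc_meas (K.image (· + x)))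
  simp only [Equiv.coe_addRight] at this
  rw [this]
  congr 1
  ext w
  simp [escSet]

lemma hit_trans (x y z : Zd d) : P (y + x) (hit (z + x)) = P y (hit z) := by
  have := sym hP (Equiv.addRight x) (fun a b => adj_add x a b) y _ (hit_meas (z + x))
  simp only [Equiv.coe_addRight] at this
  rw [this]
  congr 1
  ext w
  simp [hit]

lemma hit_symm (z : Zd d) : P z (hit 0) = P 0 (hit z) := by
  have := sym hP (Equiv.subLeft z) (fun a b => adj_sub z a b) 0 _ (hit_meas 0)
  simp only [Equiv.subLeft_apply, sub_zero] at this
  rw [this]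
  congr 1
  ext w
  simp [hit, sub_eq_zero, eq_comm]

lemma sum_ret (h : P 0 (escSet d {0}) ≠ 0) : ∑' n, P 0 {w | w n = 0} ≠ ⊤ := by
  have := hP.1
  have h1 : ∀ n, P 0 ({w | w n = 0} ∩ shift n ⁻¹' (escSet d {0})) =
      P 0 {w | w n = 0} * P 0 (escSet d {0}) := by
    intro n
    exact markov hP 0 0 n {f | f (Fin.last n) = 0} (fun f hf => hf) _ (esc_meas _)
  have h2 : ∑' n, P 0 ({w | w n = 0} ∩ shift n ⁻¹' (escSet d {0})) ≤ 1 := by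
    rw [← measure_iUnion]
    · exact prob_le_one
    · have key : ∀ n m : ℕ, n < m → Disjoint ({w | w n = 0} ∩ shift n ⁻¹' (escSet d {0}))
          ({w | w m = 0} ∩ shift m ⁻¹' (escSet d {0})) := by
        intro n m hnm
        rw [Set.disjoint_left]
        rintro w ⟨_, a⟩ ⟨b, _⟩
        have := a (m - n) (by omega)
        apply this
        simp only [shift, show n + (m - n) = m by omega]
        simpa using b
      intro n m hnm
      rcases lt_or_gt_of_ne hnm with h | h
      · exact key n m h
      · exact (key m n h).symm
    · intro n
      exact (at_meas n 0).inter (shift_meas n (esc_meas _))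
  simp only [h1, ENNReal.tsum_mul_right] at h2
  intro hc
  rw [hc, ENNReal.top_mul h] at h2
  simp at h2

lemma hit_sq (z : Zd d) (k : ℕ) : P 0 (hit z) * P 0 (hit z) ≤
    ∑ j ∈ Finset.range k, P 0 {w | w j = z} + ∑' m, P 0 {w | w (m + k) = 0} := by
  have := hP.1
  let T : (n : ℕ) → Set (Fin (n + 1) → Zd d) := fun n =>
    {f | f (Fin.last n) = z ∧ ∀ i < Fin.last n, f i ≠ z}
  have hTm : ∀ n, restr n ⁻¹' T n = {w | w n = z ∧ ∀ j < n, w j ≠ z} := by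
    intro n
    ext w
    simp only [T, restr, Set.mem_preimage, Set.mem_ofPred_eq, Fin.val_last]
    refine and_congr_right fun _ => ⟨fun h j hj => ?_, fun h i hi => h i hi⟩
    exact h ⟨j, by omega⟩ (by simpa [Fin.lt_def] using hj)
  have hmeas : ∀ n, MeasurableSet (restr n ⁻¹' T n) := fun n =>
    restr_meas n (Set.to_countable _).measurableSet
  have hdisj : Pairwise (Function.onFun Disjoint fun n => restr n ⁻¹' T n) := by
    intro n m hnm
    simp only [Function.onFun, hTm]
    rw [Set.disjoint_left]
    rintro w ⟨a, b⟩ ⟨c, e⟩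
    rcases lt_or_gt_of_ne hnm with h | h
    · exact e n h a
    · exact b m h c
  have hU : hit z = ⋃ n, restr n ⁻¹' T n := by
    classical
    ext w
    simp only [hTm, Set.mem_iUnion, hit, Set.mem_ofPred_eq]
    constructor
    · intro h
      exact ⟨Nat.find h, Nat.find_spec h, fun j hj => Nat.find_min h hj⟩
    · rintro ⟨n, h, _⟩
      exact ⟨n, h⟩
  have e1 : P 0 (hit z) * P 0 (hit z) =
      P 0 (⋃ n, restr n ⁻¹' T n ∩ shift n ⁻¹' (hit 0)) := by
    rw [measure_iUnion]
    · rw [← hit_symm hP z]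
      simp_rw [fun n => markov hP 0 z n (T n) (fun f hf => hf.1) (hit 0) (hit_meas 0)]
      rw [ENNReal.tsum_mul_right, ← measure_iUnion hdisj hmeas, ← hU, hit_symm hP z]
    · intro n m hnm
      exact (hdisj hnm).mono Set.inter_subset_left Set.inter_subset_left
    · exact fun n => (hmeas n).inter (shift_meas n (hit_meas 0))
  rw [e1]
  have hsub : (⋃ n, restr n ⁻¹' T n ∩ shift n ⁻¹' (hit 0)) ⊆
      (⋃ j ∈ Finset.range k, {w : ℕ → Zd d | w j = z}) ∪ ⋃ m, {w : ℕ → Zd d | w (m + k) = 0} := by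
    intro w hw
    simp only [hTm, Set.mem_iUnion, Set.mem_inter_iff, Set.mem_preimage, hit, shift,
      Set.mem_ofPred_eq] at hw
    obtain ⟨n, ⟨hn, _⟩, m, hm⟩ := hw
    by_cases hk : n < k
    · left
      simp only [Set.mem_iUnion, Set.mem_ofPred_eq, Finset.mem_range]
      exact ⟨n, hk, hn⟩
    · right
      simp only [Set.mem_iUnion, Set.mem_ofPred_eq]
      exact ⟨n + m - k, by rwa [show n + m - k + k = n + m by omega]⟩
  refine (measure_mono hsub).trans ((measure_union_le _ _).trans (add_le_add ?_ ?_))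
  · exact measure_biUnion_finset_le _ _
  · exact measure_iUnion_le _

lemma at_tendsto (j : ℕ) : Tendsto (fun z : Zd d => P 0 {w | w j = z}) cofinite (𝓝 0) := by
  have := hP.1
  apply ENNReal.tendsto_cofinite_zero_of_tsum_ne_top
  have := tsum_measure_preimage_singleton (μ := P 0) (f := fun w : ℕ → Zd d => w j)
    (Set.to_countable (Set.univ : Set (Zd d)))
    (fun y _ => (measurable_pi_apply j) (measurableSet_singleton y))
  rw [tsum_univ (fun b : Zd d => P 0 ((fun w : ℕ → Zd d => w j) ⁻¹' {b}))] at this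
  have h2 : ∑' z : Zd d, P 0 {w | w j = z} = 1 := this.trans (by simp)
  rw [h2]
  simp

lemma hit_tendsto (h : P 0 (escSet d {0}) ≠ 0) :
    Tendsto (fun z : Zd d => P 0 (hit z)) cofinite (𝓝 0) := by
  rw [ENNReal.tendsto_nhds_zero]
  intro ε hε
  by_cases hε' : ε = ⊤
  · simp [hε']
  have hε2 : 0 < ε * ε / 2 := ENNReal.div_pos (mul_ne_zero hε.ne' hε.ne') (by simp)
  have t1 := ENNReal.tendsto_sum_nat_add _ (sum_ret hP h)
  obtain ⟨k, hk⟩ := ((ENNReal.tendsto_nhds_zero.1 t1) _ hε2).exists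
  have t2 : Tendsto (fun z : Zd d => ∑ j ∈ Finset.range k, P 0 {w | w j = z}) cofinite (𝓝 0) := by
    have := tendsto_finsetSum (Finset.range k) (fun j _ => at_tendsto hP j)
    simpa using this
  filter_upwards [(ENNReal.tendsto_nhds_zero.1 t2) _ hε2] with z hz
  by_contra hc
  push Not at hc
  have h1 := (hit_sq hP z k).trans (add_le_add hz hk)
  rw [ENNReal.add_halves] at h1
  exact absurd (ENNReal.mul_lt_mul hc hc) (not_lt.2 h1)

lemma esc_tendsto (h : P 0 (escSet d {0}) ≠ 0) (y : Zd d) (K L : Finset (Zd d)) :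
    Tendsto (fun x : Zd d => P y (escSet d (K ∪ L.image (· + x)))) cofinite
      (𝓝 (P y (escSet d K))) := by
  have := hP.1
  have t0 : ∀ w : Zd d, Tendsto (fun x : Zd d => P y (hit (w + x))) cofinite (𝓝 0) := by
    intro w
    have e : ∀ x : Zd d, P y (hit (w + x)) = P 0 (hit (w + x - y)) := by
      intro x
      have := hit_trans hP y 0 (w + x - y)
      simpa using this
    simp only [e]
    refine (hit_tendsto hP h).comp (Function.Injective.tendsto_cofinite ?_)
    intro a b hab
    simpa using hab
  have t1 : Tendsto (fun x : Zd d => ∑ w ∈ L, P y (hit (w + x))) cofinite (𝓝 0) := by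
    simpa using tendsto_finsetSum L (fun w _ => t0 w)
  have t2 : Tendsto (fun x : Zd d => P y (escSet d K) - ∑ w ∈ L, P y (hit (w + x))) cofinite
      (𝓝 (P y (escSet d K))) := by
    simpa using ENNReal.Tendsto.sub (tendsto_const_nhds (x := P y (escSet d K))) t1
      (Or.inl (measure_ne_top _ _))
  refine tendsto_of_tendsto_of_tendsto_of_le_of_le t2 tendsto_const_nhds ?_ ?_
  · intro x
    simp only [tsub_le_iff_right]
    have hsub : escSet d K ⊆ escSet d (K ∪ L.image (· + x)) ∪ ⋃ w ∈ L, hit (w + x) := by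
      intro w hw
      by_cases hc : w ∈ ⋃ v ∈ L, hit (v + x)
      · exact Or.inr hc
      · left
        intro n hn hm
        rcases Finset.mem_union.1 hm with h1 | h1
        · exact hw n hn h1
        · obtain ⟨v, hv, hv'⟩ := Finset.mem_image.1 h1
          apply hc
          simp only [Set.mem_iUnion]
          exact ⟨v, hv, n, hv'.symm⟩
    exact (measure_mono hsub).trans ((measure_union_le _ _).trans
      (add_le_add le_rfl (measure_biUnion_finset_le _ _)))
  · intro x
    refine measure_mono ?_
    intro w hw n hn hm
    exact hw n hn (Finset.mem_union_left _ hm)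

lemma capa_trans (x : Zd d) (K : Finset (Zd d)) :
    capa d P (K.image (· + x)) = capa d P K := by
  unfold capa
  rw [Finset.sum_image (fun a _ b _ hab => by simpa using hab)]
  refine Finset.sum_congr rfl fun y hy => ?_
  unfold eqm
  rw [if_pos hy, if_pos (Finset.mem_image_of_mem _ hy), esc_trans hP]

lemma capa_top (K : Finset (Zd d)) : capa d P K ≠ ⊤ := by
  have := hP.1
  unfold capa eqm
  refine ENNReal.sum_ne_top.2 fun y hy => ?_
  rw [if_pos hy]
  exact measure_ne_top _ _

lemma capa_zero (h : P 0 (escSet d {0}) = 0) (K : Finset (Zd d)) : capa d P K = 0 := by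
  unfold capa eqm
  refine Finset.sum_eq_zero fun y hy => ?_
  rw [if_pos hy]
  have e := esc_trans hP y 0 {0}
  rw [h] at e
  simp only [zero_add, Finset.image_singleton] at e
  refine measure_mono_null ?_ e
  intro w hw n hn hm
  rw [Finset.mem_singleton] at hm
  exact hw n hn (hm ▸ hy)

lemma capa_tendsto (hd : 0 < d) (K L : Finset (Zd d)) :
    Tendsto (fun x : Zd d => capa d P (K ∪ L.image (· + x))) cofinite
      (𝓝 (capa d P K + capa d P L)) := by
  by_cases h : P 0 (escSet d {0}) = 0
  · simp only [capa_zero hP h, add_zero]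
    exact tendsto_const_nhds
  have hdis : ∀ᶠ x : Zd d in cofinite, Disjoint K (L.image (· + x)) := by
    have hf : ((K ×ˢ L).image (fun p => p.1 - p.2) : Set (Zd d)).Finite := Finset.finite_toSet _
    filter_upwards [hf.eventually_cofinite_notMem] with x hx
    rw [Finset.disjoint_left]
    intro a ha hb
    obtain ⟨b, hb', rfl⟩ := Finset.mem_image.1 hb
    apply hx
    simp only [Finset.coe_image, Set.mem_image, Finset.mem_coe, Finset.mem_product]
    exact ⟨(b + x, b), ⟨ha, hb'⟩, by simp⟩
  have t1 : Tendsto (fun x : Zd d => ∑ y ∈ K, P y (escSet d (K ∪ L.image (· + x)))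
      + ∑ y ∈ L, P y (escSet d (L ∪ K.image (· + -x)))) cofinite
      (𝓝 (capa d P K + capa d P L)) := by
    refine Tendsto.add ?_ ?_
    · have : capa d P K = ∑ y ∈ K, P y (escSet d K) :=
        Finset.sum_congr rfl fun y hy => by simp [eqm, hy]
      rw [this]
      exact tendsto_finsetSum K fun y _ => esc_tendsto hP h y K L
    · have : capa d P L = ∑ y ∈ L, P y (escSet d L) :=
        Finset.sum_congr rfl fun y hy => by simp [eqm, hy]
      rw [this]
      exact tendsto_finsetSum L fun y _ =>
        (esc_tendsto hP h y L K).comp neg_injective.tendsto_cofinite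
  refine t1.congr' ?_
  filter_upwards [hdis] with x hx
  unfold capa
  rw [Finset.sum_union hx]
  congr 1
  · exact Finset.sum_congr rfl fun y hy => by
      unfold eqm; rw [if_pos (Finset.mem_union_left _ hy)]
  · rw [Finset.sum_image (fun a _ b _ hab => by simpa using hab)]
    refine Finset.sum_congr rfl fun y hy => ?_
    unfold eqm
    rw [if_pos (Finset.mem_union_right _ (Finset.mem_image_of_mem _ hy)), ← esc_trans hP x]
    congr 2
    rw [Finset.image_union, Finset.union_comm, Finset.image_image]
    congr 1
    simp [Function.comp_def]

end

def AK (K : Finset (Zd d)) : Set (Zd d → Bool) := {ω | ∀ z ∈ K, ω z = true}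

def tau (x : Zd d) (ω : Zd d → Bool) : Zd d → Bool := fun z => ω (z + x)

lemma tau_meas (x : Zd d) : Measurable (tau x) :=
  measurable_pi_lambda _ fun _ => measurable_pi_apply _

lemma AK_meas (K : Finset (Zd d)) : MeasurableSet (AK K) := by
  have : AK K = ⋂ z ∈ K, (fun ω : Zd d → Bool => ω z) ⁻¹' {true} := by ext; simp [AK]
  rw [this]
  exact Finset.measurableSet_biInter _ fun z _ =>
    (measurable_pi_apply z) (measurableSet_singleton _)

lemma AK_inter (K L : Finset (Zd d)) : AK K ∩ AK L = AK (K ∪ L) := by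
  ext ω
  simp only [AK, Set.mem_inter_iff, Set.mem_ofPred_eq, Finset.mem_union]
  constructor
  · rintro ⟨a, b⟩ z (h | h)
    exacts [a z h, b z h]
  · exact fun h => ⟨fun z hz => h z (Or.inl hz), fun z hz => h z (Or.inr hz)⟩

lemma tau_AK (x : Zd d) (K : Finset (Zd d)) : tau x ⁻¹' AK K = AK (K.image (· + x)) := by
  ext ω; simp only [AK, tau, Set.mem_preimage, Set.mem_ofPred_eq, Finset.forall_mem_image]

lemma AK_pi : IsPiSystem {S : Set (Zd d → Bool) | ∃ K, S = AK K} := by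
  rintro _ ⟨K, rfl⟩ _ ⟨L, rfl⟩ _
  exact ⟨K ∪ L, AK_inter K L⟩

lemma AK_gen : (inferInstance : MeasurableSpace (Zd d → Bool)) =
    MeasurableSpace.generateFrom {S : Set (Zd d → Bool) | ∃ K, S = AK K} := by
  apply le_antisymm
  · refine iSup_le fun z => ?_
    rw [← measurable_iff_comap_le]
    refine @measurable_to_bool _ (MeasurableSpace.generateFrom _) _ ?_
    refine MeasurableSpace.measurableSet_generateFrom ⟨{z}, ?_⟩
    ext ω; simp [AK]
  · refine MeasurableSpace.generateFrom_le ?_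
    rintro _ ⟨K, rfl⟩
    exact AK_meas K

section
variable {P : Zd d → Measure (ℕ → Zd d)} (hP : IsSRW d P) {u : ℝ}
  {Q : Measure (Zd d → Bool)} (hQ : IsVacantLaw d P u Q)
include hP hQ

lemma Q_inv (x : Zd d) (S : Set (Zd d → Bool)) (hS : MeasurableSet S) :
    Q (tau x ⁻¹' S) = Q S := by
  have := hQ.1
  have e : Q.map (tau x) = Q := by
    have : IsProbabilityMeasure (Q.map (tau x)) :=
      Measure.isProbabilityMeasure_map (tau_meas x).aemeasurable
    refine ext_of_generate_finite _ AK_gen AK_pi ?_ (by simp)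
    rintro _ ⟨K, rfl⟩
    rw [Measure.map_apply (tau_meas x) (AK_meas K), tau_AK]
    exact (hQ.2 _).trans (by rw [capa_trans hP]; exact (hQ.2 K).symm)
  rw [← Measure.map_apply (tau_meas x) hS, e]

lemma mix_AK (hd : 0 < d) (K L : Finset (Zd d)) :
    Tendsto (fun x : Zd d => Q (AK K ∩ tau x ⁻¹' AK L)) cofinite (𝓝 (Q (AK K) * Q (AK L))) := by
  have hq : ∀ K, Q (AK K) = ENNReal.ofReal (Real.exp (-(u * (capa d P K).toReal))) := hQ.2
  simp only [tau_AK, AK_inter, hq]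
  rw [← ENNReal.ofReal_mul (Real.exp_pos _).le, ← Real.exp_add]
  refine ENNReal.tendsto_ofReal ((Real.continuous_exp.tendsto _).comp ?_)
  have t := (ENNReal.tendsto_toReal (ENNReal.add_ne_top.2 ⟨capa_top hP K, capa_top hP L⟩)).comp
    (capa_tendsto hP hd K L)
  have t2 := (t.const_mul u).neg
  rw [ENNReal.toReal_add (capa_top hP K) (capa_top hP L)] at t2
  rw [show ∀ a b : ℝ, -(u * a) + -(u * b) = -(u * (a + b)) from fun a b => by ring]
  exact t2

lemma mix (hd : 0 < d) (A : Set (Zd d → Bool)) (hA : MeasurableSet A) (L : Finset (Zd d)) :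
    Tendsto (fun x : Zd d => Q.real (A ∩ tau x ⁻¹' AK L)) cofinite
      (𝓝 (Q.real A * Q.real (AK L))) := by
  have := hQ.1
  have hm : ∀ x : Zd d, MeasurableSet (tau x ⁻¹' AK L) := fun x => tau_meas x (AK_meas L)
  induction A, hA using MeasurableSpace.induction_on_inter AK_gen AK_pi with
  | empty => simp only [Set.empty_inter, measureReal_empty, zero_mul]; exact tendsto_const_nhds
  | basic t ht =>
    obtain ⟨K, rfl⟩ := ht
    have := (ENNReal.tendsto_toReal (ENNReal.mul_ne_top (measure_ne_top _ _)
      (measure_ne_top _ _))).comp (mix_AK hP hQ hd K L)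
    rw [ENNReal.toReal_mul] at this
    exact this
  | compl t ht ih =>
    have e : ∀ x : Zd d, Q.real (tᶜ ∩ tau x ⁻¹' AK L) =
        Q.real (AK L) - Q.real (t ∩ tau x ⁻¹' AK L) := by
      intro x
      have h1 : Q.real (AK L) = Q.real (tau x ⁻¹' AK L) := by
        rw [measureReal_def, measureReal_def, Q_inv hP hQ x _ (AK_meas L)]
      have h2 := measureReal_inter_add_sdiff (μ := Q) (s := tau x ⁻¹' AK L) ht
      rw [Set.sdiff_eq, Set.inter_comm _ t, Set.inter_comm _ tᶜ] at h2
      linarith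
    simp only [e, probReal_compl_eq_one_sub ht, sub_mul, one_mul]
    exact tendsto_const_nhds.sub ih
  | iUnion f hdj hf ih =>
    have ms : ∀ g : ℕ → Set (Zd d → Bool), Pairwise (Function.onFun Disjoint g) →
        (∀ i, MeasurableSet (g i)) → Q.real (⋃ i, g i) = ∑' i, Q.real (g i) := by
      intro g h1 h2
      rw [measureReal_def, measure_iUnion h1 h2, ENNReal.tsum_toReal_eq fun i => measure_ne_top _ _]
      rfl
    have e : ∀ x : Zd d, Q.real ((⋃ i, f i) ∩ tau x ⁻¹' AK L) =
        ∑' i, Q.real (f i ∩ tau x ⁻¹' AK L) := by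
      intro x
      rw [Set.iUnion_inter, ms]
      · intro i j hij
        exact (hdj hij).mono Set.inter_subset_left Set.inter_subset_left
      · exact fun i => (hf i).inter (hm x)
    simp only [e, ms f hdj hf, ← tsum_mul_right]
    refine tendsto_tsum_of_dominated_convergence (bound := fun i => Q.real (f i)) ?_ ih ?_
    · refine ENNReal.summable_toReal ?_
      rw [← measure_iUnion hdj hf]
      exact measure_ne_top _ _
    · refine Eventually.of_forall fun x i => ?_
      rw [Real.norm_of_nonneg measureReal_nonneg]
      exact measureReal_mono Set.inter_subset_left

lemma zero_one (hd : 0 < d) (E : Set (Zd d → Bool)) (hE : MeasurableSet E)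
    (hinv : ∀ x, tau x ⁻¹' E = E) : Q E = 0 ∨ Q E = 1 := by
  have := hQ.1
  have : Nonempty (Fin d) := ⟨⟨0, hd⟩⟩
  have h1 : ∀ L, Q (E ∩ AK L) = Q E * Q (AK L) := by
    intro L
    have t := mix hP hQ hd E hE L
    have e : ∀ x : Zd d, Q.real (E ∩ tau x ⁻¹' AK L) = Q.real (E ∩ AK L) := by
      intro x
      rw [measureReal_def, measureReal_def, ← Q_inv hP hQ x _ (hE.inter (AK_meas L)),
        Set.preimage_inter, hinv]
    simp only [e] at t
    have := tendsto_nhds_unique t tendsto_const_nhds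
    rw [measureReal_def, measureReal_def, measureReal_def, ← ENNReal.toReal_mul,
      ENNReal.toReal_eq_toReal_iff' (ENNReal.mul_ne_top (measure_ne_top _ _)
        (measure_ne_top _ _)) (measure_ne_top _ _)] at this
    exact this.symm
  have h2 : Q.restrict E = Q E • Q := by
    refine ext_of_generate_finite _ AK_gen AK_pi ?_ (by simp)
    rintro _ ⟨K, rfl⟩
    rw [Measure.restrict_apply (AK_meas K), Set.inter_comm, h1]
    simp
  have h3 := congrArg (fun μ => μ E) h2
  simp only [Measure.restrict_apply hE, Set.inter_self, Measure.smul_apply, smul_eq_mul] at h3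
  by_cases h0 : Q E = 0
  · exact Or.inl h0
  · right
    have := (ENNReal.mul_eq_left h0 (measure_ne_top Q E)).1 h3.symm
    exact this

end

lemma conn_open (x y : Zd d) :
    IsOpen {ω : Zd d → Bool | connectedIn {z | ω z = true} x y} := by
  have : {ω : Zd d → Bool | connectedIn {z | ω z = true} x y} =
      ⋃ (n : ℕ), ⋃ (γ : ℕ → Zd d), ⋃ (_ : γ 0 = x ∧ γ n = y ∧ ∀ k < n, adj (γ (k + 1)) (γ k)),
        ⋂ k ∈ Finset.range (n + 1), (fun ω : Zd d → Bool => ω (γ k)) ⁻¹' {true} := by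
    ext ω
    simp only [connectedIn, Set.mem_iUnion, Set.mem_iInter, Set.mem_preimage, Finset.mem_range,
      Set.mem_singleton_iff, Set.mem_ofPred_eq, Nat.lt_succ_iff]
    constructor
    · rintro ⟨n, γ, a, b, c, e⟩
      exact ⟨n, γ, ⟨a, b, e⟩, c⟩
    · rintro ⟨n, γ, ⟨a, b, e⟩, c⟩
      exact ⟨n, γ, a, b, c, e⟩
  rw [this]
  refine isOpen_iUnion fun n => isOpen_iUnion fun γ => isOpen_iUnion fun _ => ?_
  exact isOpen_biInter_finset fun k _ => (isOpen_discrete _).preimage (continuous_apply _)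

def infAt (x : Zd d) : Set (Zd d → Bool) :=
  {ω | {y : Zd d | connectedIn {z | ω z = true} x y}.Infinite}

lemma infAt_meas (x : Zd d) : MeasurableSet (infAt x) := by
  have : infAt x = ⋂ F : Finset (Zd d), ⋃ y : Zd d, ⋃ (_ : y ∉ F),
      {ω : Zd d → Bool | connectedIn {z | ω z = true} x y} := by
    ext ω
    simp only [infAt, Set.mem_iInter, Set.mem_iUnion, Set.mem_ofPred_eq]
    constructor
    · intro h F
      obtain ⟨y, hy, hF⟩ := h.exists_notMem_finset F
      exact ⟨y, hF, hy⟩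
    · intro h hfin
      obtain ⟨y, hy, hc⟩ := h hfin.toFinset
      exact hy (hfin.mem_toFinset.2 hc)
  rw [this]
  exact MeasurableSet.iInter fun F => MeasurableSet.iUnion fun y => MeasurableSet.iUnion fun _ =>
    (conn_open x y).measurableSet

lemma conn_trans (x a b : Zd d) (ω : Zd d → Bool) :
    connectedIn {z | tau x ω z = true} a b ↔ connectedIn {z | ω z = true} (a + x) (b + x) := by
  constructor
  · rintro ⟨n, γ, h0, h1, h2, h3⟩
    exact ⟨n, fun k => γ k + x, by simp [h0], by simp [h1], h2,
      fun k hk => (adj_add x _ _).2 (h3 k hk)⟩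
  · rintro ⟨n, γ, h0, h1, h2, h3⟩
    refine ⟨n, fun k => γ k - x, by simp [h0], by simp [h1], ?_, fun k hk => ?_⟩
    · intro k hk
      have := h2 k hk
      simpa [tau] using this
    · rw [← adj_add x]
      simpa using h3 k hk

lemma infAt_trans (x a : Zd d) : tau x ⁻¹' infAt a = infAt (a + x) := by
  ext ω
  simp only [infAt, Set.mem_preimage, Set.mem_ofPred_eq, conn_trans]
  have : {y | connectedIn {z | ω z = true} (a + x) y} =
      (Equiv.addRight x) '' {y | connectedIn {z | ω z = true} (a + x) (y + x)} := by
    ext y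
    simp only [Set.mem_image, Set.mem_ofPred_eq, Equiv.coe_addRight]
    constructor
    · intro h
      exact ⟨y - x, by simpa using h, by simp⟩
    · rintro ⟨v, hv, rfl⟩
      exact hv
  rw [this, Set.infinite_image_iff (Equiv.injective _).injOn]

end VP

/-- **Theorem 2.1 (2.4) and Corollary 2.3 (2.16a): zero-one law for percolation.**
The probability that the vacant set percolates is `0` or `1`, and it is `1` exactly
when `η(u) > 0`. -/
theorem vacant_percolation_zero_one
    (d : ℕ) (hd : 3 ≤ d) (P : Zd d → Measure (ℕ → Zd d)) (hP : IsSRW d P)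
    (u : ℝ) (hu : 0 ≤ u) (Q : Measure (Zd d → Bool)) (hQ : IsVacantLaw d P u Q) :
    (Q {ω | ∃ x : Zd d, {y : Zd d | connectedIn {z | ω z = true} x y}.Infinite} = 0
      ∨ Q {ω | ∃ x : Zd d, {y : Zd d | connectedIn {z | ω z = true} x y}.Infinite} = 1)
    ∧ (Q {ω | ∃ x : Zd d, {y : Zd d | connectedIn {z | ω z = true} x y}.Infinite} = 1
        ↔ 0 < Q {ω | {y : Zd d | connectedIn {z | ω z = true} (0 : Zd d) y}.Infinite}) := by
  have hd0 : 0 < d := by omega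
  have hp := hQ.1
  have hE : {ω : Zd d → Bool | ∃ x : Zd d, {y : Zd d | connectedIn {z | ω z = true} x y}.Infinite} =
      ⋃ x, VP.infAt x := by
    ext ω
    simp only [VP.infAt, Set.mem_iUnion, Set.mem_ofPred_eq]
  have hE0 : {ω : Zd d → Bool | {y : Zd d | connectedIn {z | ω z = true} (0 : Zd d) y}.Infinite} =
      VP.infAt 0 := rfl
  rw [hE, hE0]
  have hinv : ∀ x, VP.tau x ⁻¹' (⋃ a : Zd d, VP.infAt a) = ⋃ a : Zd d, VP.infAt a := by
    intro x
    simp only [Set.preimage_iUnion, VP.infAt_trans]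
    exact (Equiv.addRight x).surjective.iUnion_comp VP.infAt
  have h01 := VP.zero_one hP hQ hd0 _ (MeasurableSet.iUnion VP.infAt_meas) hinv
  refine ⟨h01, ?_⟩
  have hx : ∀ x : Zd d, Q (VP.infAt x) = Q (VP.infAt 0) := by
    intro x
    rw [← VP.Q_inv hP hQ x _ (VP.infAt_meas 0), VP.infAt_trans, zero_add]
  constructor
  · intro h
    rw [pos_iff_ne_zero]
    intro h0
    have : Q (⋃ x : Zd d, VP.infAt x) = 0 := measure_iUnion_null fun x => (hx x).trans h0
    rw [this] at h
    exact zero_ne_one h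
  · intro h
    refine h01.resolve_left fun h0 => ?_
    exact h.ne' (measure_mono_null (Set.subset_iUnion VP.infAt 0) h0)
end
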